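/- arXiv:1603.07056 — 7 statements merged into one kernel-verified Lean document; each statement's English description precedes it below -/
import Mathlib

section
/- For every ε > 0 there exists t₀ such that for every integer t ≥ t₀ and every positive integer n, every simple graph on n vertices with no K_t-minor has at most 3^{(2/3+ε)t} · n cliques. -/
/-- `H` is a minor of `G`: there are disjoint nonempty connected branch sets in `G`,
one for each vertex of `H`, with an edge of `G` between the branch sets of any two
vertices adjacent in `H`. -/
def SimpleGraph.IsMinor {W V : Type*} (H : SimpleGraph W) (G : SimpleGraph V) : Prop :=
  ∃ f : W → Set V,
    (∀ w, (f w).Nonempty) ∧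
    (∀ w, (G.induce (f w)).Connected) ∧
    (Pairwise fun w₁ w₂ => Disjoint (f w₁) (f w₂)) ∧
    ∀ ⦃w₁ w₂⦄, H.Adj w₁ w₂ → ∃ v₁ ∈ f w₁, ∃ v₂ ∈ f w₂, G.Adj v₁ v₂

/-- The number of cliques (vertex subsets inducing complete subgraphs, including `∅`). -/
noncomputable def SimpleGraph.cliqueCount {V : Type*} [Fintype V] (G : SimpleGraph V) : ℕ :=
  Nat.card {s : Finset V // G.IsClique (s : Set V)}

/-- The number of cliques containing a given vertex. -/
noncomputable def SimpleGraph.cliqueCountOn {V : Type*} [Fintype V] (G : SimpleGraph V)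
    (v : V) : ℕ :=
  Nat.card {s : Finset V // G.IsClique (s : Set V) ∧ v ∈ s}

/-- The Hadwiger number: the largest `t` such that `K_t` is a minor of `G`. -/
noncomputable def SimpleGraph.hadwigerNumber {V : Type*} [Fintype V] (G : SimpleGraph V) : ℕ :=
  sSup {t | (completeGraph (Fin t)).IsMinor G}

/-- The matching number: the maximum number of edges of a matching in `G`. -/
noncomputable def SimpleGraph.matchingNumber {V : Type*} [Fintype V] (G : SimpleGraph V) : ℕ :=
  sSup {k | ∃ M : G.Subgraph, M.IsMatching ∧ M.edgeSet.ncard = k}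

namespace SimpleGraph

section

open scoped Classical

variable {V : Type*} {G : SimpleGraph V} {S T : Finset V}

/-- The neighbours of `v` inside `S`. -/
noncomputable def nbrsIn (G : SimpleGraph V) (S : Finset V) (v : V) : Finset V :=
  S.filter (G.Adj v)

/-- The cliques contained in `S`. -/
noncomputable def cliquesIn (G : SimpleGraph V) (S : Finset V) : Finset (Finset V) :=
  S.powerset.filter fun K => G.IsClique (K : Set V)

/-- `K_s` is a minor of `G` with all branch sets inside `S`. -/
def HasCompleteMinorIn (G : SimpleGraph V) (S : Finset V) (s : ℕ) : Prop :=
  ∃ f : Fin s → Set V, (∀ i, f i ⊆ S) ∧ (∀ i, (f i).Nonempty) ∧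
    (∀ i, (G.induce (f i)).Connected) ∧ (Pairwise fun i j => Disjoint (f i) (f j)) ∧
    ∀ i j, i ≠ j → ∃ x ∈ f i, ∃ y ∈ f j, G.Adj x y

lemma mem_nbrsIn {u v : V} : u ∈ G.nbrsIn S v ↔ u ∈ S ∧ G.Adj v u := by
  simp [nbrsIn]

lemma nbrsIn_subset (v : V) : G.nbrsIn S v ⊆ S := Finset.filter_subset _ _

lemma mem_cliquesIn {K : Finset V} : K ∈ G.cliquesIn S ↔ K ⊆ S ∧ G.IsClique (K : Set V) := by
  simp [cliquesIn]

/-! ### Counting cliques -/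

lemma card_nbrsIn_lt {v : V} (hv : v ∈ S) : (G.nbrsIn S v).card < S.card := by
  apply Finset.card_lt_card
  refine ⟨nbrsIn_subset v, fun h => ?_⟩
  simpa using (mem_nbrsIn.1 (h hv)).2

lemma erase_mem_cliquesIn_nbrsIn {K : Finset V} {u : V} (hK : K ∈ G.cliquesIn S) (hu : u ∈ K) :
    K.erase u ∈ G.cliquesIn (G.nbrsIn S u) := by
  rw [mem_cliquesIn] at hK ⊢
  refine ⟨fun x hx => ?_, hK.2.subset (by simp)⟩
  rw [Finset.mem_erase] at hx
  exact mem_nbrsIn.2 ⟨hK.1 hx.2, hK.2 (by simpa using hu) (by simpa using hx.2) hx.1.symm⟩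

lemma card_cliquesIn_filter_mem_le (u : V) :
    ((G.cliquesIn S).filter (u ∈ ·)).card ≤ (G.cliquesIn (G.nbrsIn S u)).card := by
  apply Finset.card_le_card_of_injOn (fun K => K.erase u)
  · intro K hK
    simp only [Finset.coe_filter, Set.mem_ofPred_eq] at hK
    exact erase_mem_cliquesIn_nbrsIn hK.1 hK.2
  · intro K hK L hL h
    simp only [Finset.coe_filter, Set.mem_ofPred_eq] at hK hL
    rw [← Finset.insert_erase hK.2, ← Finset.insert_erase hL.2]
    exact congrArg _ h

lemma card_cliquesIn_le_add (T : Finset V) :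
    (G.cliquesIn S).card ≤ (G.cliquesIn (S \ T)).card +
      ∑ u ∈ T, (G.cliquesIn (G.nbrsIn S u)).card := by
  have hsub : G.cliquesIn S ⊆ G.cliquesIn (S \ T) ∪
      T.biUnion fun u => (G.cliquesIn S).filter (u ∈ ·) := by
    intro K hK
    by_cases h : ∃ u ∈ T, u ∈ K
    · obtain ⟨u, hu, huK⟩ := h
      exact Finset.mem_union_right _ (Finset.mem_biUnion.2 ⟨u, hu, by simp [hK, huK]⟩)
    · push Not at h
      refine Finset.mem_union_left _ ?_
      rw [mem_cliquesIn] at hK ⊢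
      exact ⟨fun x hx => Finset.mem_sdiff.2 ⟨hK.1 hx, fun hxT => h x hxT hx⟩, hK.2⟩
  calc _ ≤ _ := Finset.card_le_card hsub
    _ ≤ _ := Finset.card_union_le _ _
    _ ≤ _ := by
      gcongr
      exact Finset.card_biUnion_le.trans
        (Finset.sum_le_sum fun u _ => card_cliquesIn_filter_mem_le u)

lemma card_cliquesIn_le_erase_add (v : V) :
    (G.cliquesIn S).card ≤ (G.cliquesIn (S.erase v)).card +
      (G.cliquesIn (G.nbrsIn S v)).card := by
  simpa [Finset.sdiff_singleton_eq_erase] using card_cliquesIn_le_add (G := G) (S := S) {v}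

lemma card_cliquesIn_empty : (G.cliquesIn ∅).card = 1 := by
  rw [Finset.card_eq_one]
  refine ⟨∅, Finset.ext fun K => ?_⟩
  rw [mem_cliquesIn, Finset.subset_empty, Finset.mem_singleton]
  exact ⟨fun h => h.1, fun h => ⟨h, by simp [h]⟩⟩

lemma le_three_rpow (k : ℕ) : (k : ℝ) ≤ (3 : ℝ) ^ ((k : ℝ) / 3) := by
  have hnat : k ^ 3 ≤ 3 ^ k := by
    by_cases hk : k ≤ 3
    · interval_cases k <;> norm_num
    · induction k, (not_le.1 hk : 4 ≤ k) using Nat.le_induction with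
      | base => norm_num
      | succ n hn ih =>
        have := ih (by omega)
        rw [pow_succ 3 n]
        nlinarith [Nat.mul_le_mul hn hn, Nat.mul_le_mul (Nat.mul_le_mul hn hn) hn,
          Nat.mul_le_mul_left (n * n) hn]
  have hpow : ((3 : ℝ) ^ ((k : ℝ) / 3)) ^ 3 = 3 ^ k := by
    rw [← Real.rpow_natCast, ← Real.rpow_mul (by norm_num), ← Real.rpow_natCast]
    congr 1
    push_cast
    ring
  refine le_of_pow_le_pow_left₀ (n := 3) (by norm_num) (by positivity) ?_
  rw [hpow]
  exact_mod_cast hnat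

/-- A graph on `m` vertices with clique number at most `ω` has at most `3 ^ ((m + ω) / 3)`
cliques. -/
lemma card_cliquesIn_le_of_forall_card_le (ω : ℕ) (h : ∀ K ∈ G.cliquesIn S, K.card ≤ ω) :
    ((G.cliquesIn S).card : ℝ) ≤ (3 : ℝ) ^ (((S.card + ω : ℕ) : ℝ) / 3) := by
  induction hm : S.card using Nat.strong_induction_on generalizing S ω with
  | _ m ih =>
    subst hm
    rcases S.eq_empty_or_nonempty with rfl | hS
    · rw [card_cliquesIn_empty]
      exact_mod_cast Real.one_le_rpow (by norm_num) (by positivity)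
    obtain ⟨v, hv, hmax⟩ := Finset.exists_max_image S (fun u => (G.nbrsIn S u).card) hS
    obtain ⟨ω, rfl⟩ : ∃ ω', ω = ω' + 1 := by
      have := h {v} (mem_cliquesIn.2 ⟨by simpa using hv, by simp⟩)
      exact ⟨ω - 1, by simp at this; omega⟩
    have hbound : ∀ u ∈ S, ((G.cliquesIn (G.nbrsIn S u)).card : ℝ) ≤
        (3 : ℝ) ^ ((((G.nbrsIn S v).card + ω : ℕ) : ℝ) / 3) := by
      intro u hu
      refine (ih _ (card_nbrsIn_lt hu) (S := G.nbrsIn S u) ω (fun K hK => ?_) rfl).trans ?_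
      · rw [mem_cliquesIn] at hK
        have huK : u ∉ K := fun hmem => by simpa using (mem_nbrsIn.1 (hK.1 hmem)).2
        have := h (insert u K) (mem_cliquesIn.2 ⟨Finset.insert_subset hu
          (hK.1.trans (nbrsIn_subset u)), by
            rw [Finset.coe_insert, isClique_insert]
            exact ⟨hK.2, fun x hx _ => (mem_nbrsIn.1 (hK.1 hx)).2⟩⟩)
        rw [Finset.card_insert_of_notMem huK] at this
        omega
      · refine Real.rpow_le_rpow_of_exponent_le (by norm_num) ?_
        have := hmax u hu
        gcongr
    have hcount := card_cliquesIn_le_add (G := G) (S := S) (S \ G.nbrsIn S v)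
    rw [Finset.sdiff_sdiff_eq_self (nbrsIn_subset v)] at hcount
    have hcard : (S \ G.nbrsIn S v).card + (G.nbrsIn S v).card = S.card :=
      Finset.card_sdiff_add_card_eq_card (nbrsIn_subset v)
    set d := (S \ G.nbrsIn S v).card
    set B := (3 : ℝ) ^ ((((G.nbrsIn S v).card + ω : ℕ) : ℝ) / 3)
    calc ((G.cliquesIn S).card : ℝ) ≤ (G.cliquesIn (G.nbrsIn S v)).card +
          ∑ u ∈ S \ G.nbrsIn S v, ((G.cliquesIn (G.nbrsIn S u)).card : ℝ) := by
          exact_mod_cast hcount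
      _ ≤ B + ∑ u ∈ S \ G.nbrsIn S v, B := by
          gcongr with u hu
          · exact hbound v hv
          · exact hbound u (Finset.sdiff_subset hu)
      _ = ((d + 1 : ℕ) : ℝ) * B := by
          rw [Finset.sum_const, nsmul_eq_mul]
          push_cast
          ring
      _ ≤ (3 : ℝ) ^ (((d + 1 : ℕ) : ℝ) / 3) * B := by
          gcongr
          exact le_three_rpow _
      _ = _ := by
          rw [← Real.rpow_add (by norm_num), ← hcard]
          congr 1
          push_cast
          ring

/-- Branching on vertices with many non-neighbours reduces clique counting to subsets in which
every vertex has at most a `1 / (p + 1)` proportion of non-neighbours. -/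
lemma card_cliquesIn_le_mul_pow (p d : ℕ) (B : ℝ) (hB : 0 ≤ B) (R : Finset V)
    (h : ∀ T ⊆ R, (∀ v ∈ T, (T.card - (G.nbrsIn T v).card) * (p + 1) ≤ T.card) →
      ((G.cliquesIn T).card : ℝ) ≤ B) (j : ℕ) (hSR : S ⊆ R) (hSd : S.card ≤ d)
    (hj : S.card * p ^ j < (p + 1) ^ j) :
    ((G.cliquesIn S).card : ℝ) ≤ B * (d + 1) ^ j := by
  induction j generalizing S with
  | zero =>
    have : S = ∅ := by simpa using hj
    subst this
    simpa using h ∅ hSR (by simp)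
  | succ j ih =>
    have key : ∀ S ⊆ R, S.card ≤ d → S.card * p ^ (j + 1) < (p + 1) ^ (j + 1) →
        ((G.cliquesIn S).card : ℝ) ≤ B * (d + 1) ^ j * (S.card + 1) := by
      intro S
      induction hm : S.card using Nat.strong_induction_on generalizing S with
      | _ m ihm =>
        subst hm
        intro hSR hSd hj
        by_cases hT : ∀ v ∈ S, (S.card - (G.nbrsIn S v).card) * (p + 1) ≤ S.card
        · refine (h S hSR hT).trans ?_
          rw [mul_assoc]
          refine le_mul_of_one_le_right hB ?_
          have : (1 : ℝ) ≤ (d + 1) ^ j := one_le_pow₀ (by linarith [d.cast_nonneg (α := ℝ)])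
          nlinarith [S.card.cast_nonneg (α := ℝ)]
        · push Not at hT
          obtain ⟨v, hv, hlt⟩ := hT
          have hcard := Finset.card_erase_add_one hv
          have herase := ihm _ (by omega) (S.erase v) rfl ((Finset.erase_subset _ _).trans hSR)
            (by omega) (lt_of_le_of_lt (Nat.mul_le_mul_right _ Finset.card_erase_le) hj)
          have hle := card_nbrsIn_lt (G := G) hv
          have hnbrs := ih (S := G.nbrsIn S v) ((nbrsIn_subset v).trans hSR) (by omega) (by
            obtain ⟨e, he⟩ := Nat.exists_eq_add_of_lt hle
            have hlt' : (G.nbrsIn S v).card * (p + 1) ≤ S.card * p := by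
              have : (S.card - (G.nbrsIn S v).card) = e + 1 := by omega
              rw [this] at hlt
              nlinarith
            refine lt_of_mul_lt_mul_right (a := p + 1) ?_ (by omega)
            calc (G.nbrsIn S v).card * p ^ j * (p + 1)
                = (G.nbrsIn S v).card * (p + 1) * p ^ j := by ring
              _ ≤ S.card * p * p ^ j := by gcongr
              _ = S.card * p ^ (j + 1) := by ring
              _ < (p + 1) ^ (j + 1) := hj
              _ = _ := by ring)
          have hsum : ((G.cliquesIn S).card : ℝ) ≤ (G.cliquesIn (S.erase v)).card +
            (G.cliquesIn (G.nbrsIn S v)).card := by exact_mod_cast card_cliquesIn_le_erase_add v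
          have hcard' : (S.card : ℝ) = (S.erase v).card + 1 := by exact_mod_cast hcard.symm
          rw [hcard']
          linarith
    refine (key S hSR hSd hj).trans ?_
    rw [pow_succ, ← mul_assoc]
    gcongr

/-! ### Complete minors inside a vertex set -/

lemma HasCompleteMinorIn.mono {s : ℕ} (h : G.HasCompleteMinorIn S s) (hST : S ⊆ T) :
    G.HasCompleteMinorIn T s := by
  obtain ⟨f, hsub, h⟩ := h
  exact ⟨f, fun i => (hsub i).trans (by exact_mod_cast hST), h⟩

lemma HasCompleteMinorIn.of_le {s t : ℕ} (h : G.HasCompleteMinorIn S s) (hts : t ≤ s) :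
    G.HasCompleteMinorIn S t := by
  obtain ⟨f, hsub, hne, hconn, hdisj, hadj⟩ := h
  have hinj := Fin.castLE_injective hts
  exact ⟨fun i => f (Fin.castLE hts i), fun i => hsub _, fun i => hne _, fun i => hconn _,
    fun i j hij => hdisj (hinj.ne hij), fun i j hij => hadj _ _ (hinj.ne hij)⟩

lemma HasCompleteMinorIn.isMinor {s : ℕ} (h : G.HasCompleteMinorIn S s) :
    (completeGraph (Fin s)).IsMinor G := by
  obtain ⟨f, -, hne, hconn, hdisj, hadj⟩ := h
  exact ⟨f, hne, hconn, hdisj, fun i j hij => hadj i j hij.ne⟩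

lemma hasCompleteMinorIn_zero : G.HasCompleteMinorIn S 0 :=
  ⟨fun i => i.elim0, fun i => i.elim0, fun i => i.elim0, fun i => i.elim0,
    fun i => i.elim0, fun i => i.elim0⟩

/-- A complete minor can be extended by a disjoint connected set adjacent to all branch sets. -/
lemma HasCompleteMinorIn.union {s : ℕ} (h : G.HasCompleteMinorIn S s) (hne : T.Nonempty)
    (hdisj : Disjoint S T) (hconn : (G.induce (T : Set V)).Connected)
    (hdom : ∀ x ∈ S, ∃ y ∈ T, G.Adj x y) : G.HasCompleteMinorIn (S ∪ T) (s + 1) := by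
  obtain ⟨f, hsub, hfne, hfconn, hfdisj, hadj⟩ := h
  have hT : ∀ i, Disjoint (f i) (T : Set V) := fun i =>
    (Finset.disjoint_coe.2 hdisj).mono_left (hsub i)
  have hTadj : ∀ i, ∃ x ∈ f i, ∃ y ∈ (T : Set V), G.Adj x y := fun i => by
    obtain ⟨x, hx⟩ := hfne i
    obtain ⟨y, hy, hxy⟩ := hdom x (hsub i hx)
    exact ⟨x, hx, y, hy, hxy⟩
  refine ⟨Fin.cons (T : Set V) f, fun i => ?_, fun i => ?_, fun i => ?_, fun i j hij => ?_,
    fun i j hij => ?_⟩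
  · cases i using Fin.cases with
    | zero => simp
    | succ i => simpa using (hsub i).trans Set.subset_union_left
  · cases i using Fin.cases with
    | zero => simpa using hne
    | succ i => simpa using hfne i
  · cases i using Fin.cases with
    | zero => exact hconn
    | succ i => exact hfconn i
  · cases i using Fin.cases with
    | zero => cases j using Fin.cases with
      | zero => exact absurd rfl hij
      | succ j => simpa using (hT j).symm
    | succ i => cases j using Fin.cases with
      | zero => simpa using hT i
      | succ j => simpa using hfdisj fun h => hij (congrArg Fin.succ h)
  · cases i using Fin.cases with
    | zero => cases j using Fin.cases with
      | zero => exact absurd rfl hij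
      | succ j =>
        obtain ⟨x, hx, y, hy, hxy⟩ := hTadj j
        exact ⟨y, hy, x, hx, hxy.symm⟩
    | succ i => cases j using Fin.cases with
      | zero => exact hTadj i
      | succ j => exact hadj i j fun h => hij (congrArg Fin.succ h)

lemma HasCompleteMinorIn.of_isClique {K : Finset V} (hK : G.IsClique (K : Set V)) :
    G.HasCompleteMinorIn K K.card := by
  induction K using Finset.induction_on with
  | empty => exact hasCompleteMinorIn_zero
  | insert v K hv ih =>
    rw [Finset.coe_insert, isClique_insert] at hK
    rw [Finset.card_insert_of_notMem hv, Finset.insert_eq, Finset.union_comm]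
    refine (ih hK.1).union (by simp) (by simpa using hv) ?_ ?_
    · rw [Finset.coe_singleton]
      exact ⟨.of_subsingleton⟩
    · intro x hx
      exact ⟨v, by simp, (hK.2 x hx (by rintro rfl; exact hv hx)).symm⟩

/-- In a dense vertex set, a complete minor using few vertices extends by an edge. -/
lemma exists_extending_pair {U : Finset V} (q h t : ℕ) (hq0 : 0 < q) (hUT : U ⊆ T)
    (hU : U.card ≤ 2 * t)
    (hq : h ^ 2 * (q + 2 * t) ≤ q ^ 2)
    (hT : ∀ v ∈ T, (T.card - (G.nbrsIn T v).card) * q ≤ T.card)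
    (hpool : T.card < h * (T \ U).card) :
    ∃ a ∈ T \ U, ∃ b ∈ T \ U, G.Adj a b ∧ ∀ x ∈ U, G.Adj x a ∨ G.Adj x b := by
  by_contra hcon
  push Not at hcon
  set m := T.card
  set P := T \ U
  have hPT : P ⊆ T := Finset.sdiff_subset
  have hnon : ∀ v ∈ T, (T \ G.nbrsIn T v).card * q ≤ m := fun v hv => by
    rw [Finset.card_sdiff_of_subset (nbrsIn_subset v)]
    exact hT v hv
  have hcover : P ×ˢ P ⊆ (P.biUnion fun a => {a} ×ˢ (T \ G.nbrsIn T a)) ∪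
      U.biUnion fun x => (T \ G.nbrsIn T x) ×ˢ (T \ G.nbrsIn T x) := by
    rintro ⟨a, b⟩ hab
    rw [Finset.mem_product] at hab
    simp only [Finset.mem_union, Finset.mem_biUnion, Finset.mem_product, Finset.mem_singleton,
      Finset.mem_sdiff, mem_nbrsIn]
    by_cases hadj : G.Adj a b
    · obtain ⟨x, hx, hxa, hxb⟩ := hcon a hab.1 b hab.2 hadj
      exact Or.inr ⟨x, hx, ⟨hPT hab.1, fun h => hxa h.2⟩, hPT hab.2, fun h => hxb h.2⟩
    · exact Or.inl ⟨a, hab.1, rfl, hPT hab.2, fun h => hadj h.2⟩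
  have hcard : P.card * P.card ≤ ∑ a ∈ P, (T \ G.nbrsIn T a).card +
      ∑ x ∈ U, (T \ G.nbrsIn T x).card * (T \ G.nbrsIn T x).card := by
    calc P.card * P.card = (P ×ˢ P).card := (Finset.card_product _ _).symm
      _ ≤ _ := Finset.card_le_card hcover
      _ ≤ _ := Finset.card_union_le _ _
      _ ≤ _ := by
        gcongr
        · exact Finset.card_biUnion_le.trans (by simp)
        · exact Finset.card_biUnion_le.trans (by simp)
  have hA : (∑ a ∈ P, (T \ G.nbrsIn T a).card) * q ≤ m * m := by
    rw [Finset.sum_mul]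
    calc _ ≤ ∑ a ∈ P, m := Finset.sum_le_sum fun a ha => hnon a (hPT ha)
      _ = P.card * m := by simp
      _ ≤ m * m := Nat.mul_le_mul_right m (Finset.card_le_card hPT)
  have hB : (∑ x ∈ U, (T \ G.nbrsIn T x).card * (T \ G.nbrsIn T x).card) * q ^ 2 ≤
      2 * t * (m * m) := by
    rw [Finset.sum_mul]
    calc _ ≤ ∑ x ∈ U, m * m := Finset.sum_le_sum fun x hx => by
            calc _ = ((T \ G.nbrsIn T x).card * q) * ((T \ G.nbrsIn T x).card * q) := by ring
              _ ≤ m * m := Nat.mul_le_mul (hnon x (hUT hx)) (hnon x (hUT hx))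
      _ = U.card * (m * m) := by simp
      _ ≤ _ := by gcongr
  have hq2 : P.card * P.card * q ^ 2 ≤ (m * m) * (q + 2 * t) := by
    calc _ ≤ _ := Nat.mul_le_mul_right (q ^ 2) hcard
      _ = (∑ a ∈ P, (T \ G.nbrsIn T a).card) * q * q +
          (∑ x ∈ U, (T \ G.nbrsIn T x).card * (T \ G.nbrsIn T x).card) * q ^ 2 := by ring
      _ ≤ m * m * q + 2 * t * (m * m) := by gcongr
      _ = _ := by ring
  have hsq : m * m < (h * P.card) * (h * P.card) := Nat.mul_lt_mul'' hpool hpool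
  have : (m * m) * (q + 2 * t) < (m * m) * (q + 2 * t) := by
    calc _ < (h * P.card) * (h * P.card) * (q + 2 * t) := Nat.mul_lt_mul_of_pos_right hsq (by omega)
      _ = P.card * P.card * (h ^ 2 * (q + 2 * t)) := by ring
      _ ≤ P.card * P.card * q ^ 2 := by gcongr
      _ ≤ _ := hq2
  exact lt_irrefl _ this

lemma exists_hasCompleteMinorIn_of_clique {K : Finset V} (q h t : ℕ) (hq0 : 0 < q)
    (hq : h ^ 2 * (q + 2 * t) ≤ q ^ 2)
    (hT : ∀ v ∈ T, (T.card - (G.nbrsIn T v).card) * q ≤ T.card) (hK : K ∈ G.cliquesIn T) (j : ℕ)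
    (hjt : K.card + 2 * j ≤ 2 * t) (hj : T.card + h * (K.card + 2 * j) < h * T.card) :
    ∃ U ⊆ T, U.card = K.card + 2 * j ∧ G.HasCompleteMinorIn U (K.card + j) := by
  rw [mem_cliquesIn] at hK
  induction j with
  | zero => exact ⟨K, hK.1, rfl, .of_isClique hK.2⟩
  | succ j ih =>
    obtain ⟨U, hUT, hUcard, hU⟩ := ih (by omega) (by nlinarith)
    obtain ⟨a, ha, b, hb, hab, hdom⟩ := exists_extending_pair q h t hq0 hUT (by omega) hq hT (by
      rw [Finset.card_sdiff_of_subset hUT, Nat.mul_sub, hUcard]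
      have : h * (K.card + 2 * j) ≤ h * (K.card + 2 * (j + 1)) := by gcongr; omega
      omega)
    rw [Finset.mem_sdiff] at ha hb
    have hdisj : Disjoint U {a, b} := by simp [ha.2, hb.2]
    refine ⟨U ∪ {a, b}, Finset.union_subset hUT (by simp [Finset.insert_subset_iff, ha.1, hb.1]),
      ?_, ?_⟩
    · rw [Finset.card_union_of_disjoint hdisj, Finset.card_pair hab.ne, hUcard]
      ring
    · refine hU.union (by simp) hdisj ?_ fun x hx => ?_
      · rw [Finset.coe_pair]
        exact induce_pair_connected_of_adj hab
      · rcases hdom x hx with h | h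
        · exact ⟨a, by simp, h⟩
        · exact ⟨b, by simp, h⟩

/-- If every vertex of `T` has few non-neighbours in `T` and `T` hosts no `K_t`-minor, then
`|T| + ω(T)` is at most about `2 t`. -/
lemma card_add_card_le_of_not_hasCompleteMinorIn {K : Finset V} (q h t : ℕ) (hq0 : 0 < q)
    (hq : h ^ 2 * (q + 2 * t) ≤ q ^ 2)
    (hT : ∀ v ∈ T, (T.card - (G.nbrsIn T v).card) * q ≤ T.card) (hK : K ∈ G.cliquesIn T)
    (hminor : ¬ G.HasCompleteMinorIn T t) :
    h * (T.card + K.card) ≤ 2 * t * h + T.card := by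
  have hK' := mem_cliquesIn.1 hK
  have hlt : K.card < t := by
    by_contra hle
    exact hminor (((HasCompleteMinorIn.of_isClique hK'.2).mono hK'.1).of_le (not_lt.1 hle))
  by_contra hcon
  obtain ⟨j, rfl⟩ := Nat.exists_eq_add_of_le hlt.le
  obtain ⟨U, hUT, -, hU⟩ := exists_hasCompleteMinorIn_of_clique q h (K.card + j) hq0 hq hT hK j
    (by omega) (by nlinarith)
  exact hminor (hU.mono hUT)

/-! ### Graphs with many edges have a large complete minor -/

/-- The Ramsey bound `R(3, t) ≤ t ^ 2`: if among any three elements of `A` some two are related,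
then `A` contains `t` pairwise related elements. -/
lemma exists_pairwise_of_three {r : V → V → Prop} {A : Finset V} (t : ℕ)
    (hr : ∀ x ∈ A, ∀ y ∈ A, ∀ z ∈ A, x ≠ y → y ≠ z → x ≠ z → r x y ∨ r y z ∨ r x z)
    (hsymm : ∀ x y, r x y → r y x) (hA : t * t ≤ A.card) :
    ∃ R ⊆ A, R.card = t ∧ ∀ x ∈ R, ∀ y ∈ R, x ≠ y → r x y := by
  rcases t.eq_zero_or_pos with rfl | ht
  · exact ⟨∅, by simp, by simp, by simp⟩
  by_cases hpoor : ∃ x ∈ A, t ≤ (A.filter fun y => y ≠ x ∧ ¬ r x y).card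
  · obtain ⟨x, hx, ht⟩ := hpoor
    obtain ⟨R, hR, hRt⟩ := Finset.exists_subset_card_eq ht
    refine ⟨R, hR.trans (Finset.filter_subset _ _), hRt, fun y hy z hz hyz => ?_⟩
    have hy' := Finset.mem_filter.1 (hR hy)
    have hz' := Finset.mem_filter.1 (hR hz)
    rcases hr x hx y hy'.1 z hz'.1 hy'.2.1.symm hyz hz'.2.1.symm with h | h | h
    · exact absurd h hy'.2.2
    · exact h
    · exact absurd h hz'.2.2
  · push Not at hpoor
    have key : ∀ j, ∀ B ⊆ A, j * t ≤ B.card →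
        ∃ R ⊆ B, R.card = j ∧ ∀ x ∈ R, ∀ y ∈ R, x ≠ y → r x y := by
      intro j
      induction j with
      | zero => exact fun B _ _ => ⟨∅, by simp, by simp, by simp⟩
      | succ j ih =>
        intro B hBA hB
        obtain ⟨x, hx⟩ : B.Nonempty := Finset.card_pos.1 (by nlinarith)
        have hlt := hpoor x (hBA hx)
        have hcard : j * t ≤ (B.filter fun y => y ≠ x ∧ r x y).card := by
          have hcover : B ⊆ (B.filter fun y => y ≠ x ∧ r x y) ∪
              insert x (A.filter fun y => y ≠ x ∧ ¬ r x y) := by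
            intro y hy
            have := hBA hy
            by_cases hyx : y = x <;> by_cases hrxy : r x y <;> simp [*]
          have h1 := Finset.card_le_card hcover
          have h2 := Finset.card_union_le (B.filter fun y => y ≠ x ∧ r x y)
            (insert x (A.filter fun y => y ≠ x ∧ ¬ r x y))
          have h3 := Finset.card_insert_le x (A.filter fun y => y ≠ x ∧ ¬ r x y)
          have h4 : (j + 1) * t = j * t + t := by ring
          omega
        obtain ⟨R, hR, hRj, hrich⟩ := ih _ ((Finset.filter_subset _ _).trans hBA) hcard
        have hRx : ∀ y ∈ R, y ≠ x ∧ r x y := fun y hy => (Finset.mem_filter.1 (hR hy)).2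
        refine ⟨insert x R, Finset.insert_subset hx (hR.trans (Finset.filter_subset _ _)), ?_, ?_⟩
        · rw [Finset.card_insert_of_notMem fun h => (hRx x h).1 rfl, hRj]
        · intro y hy z hz hyz
          rw [Finset.mem_insert] at hy hz
          rcases hy with rfl | hy <;> rcases hz with rfl | hz
          · exact absurd rfl hyz
          · exact (hRx z hz).2
          · exact hsymm _ _ (hRx y hy).2
          · exact hrich y hy z hz hyz
    exact key t A subset_rfl hA

/-- Vertices with pairwise many common neighbours are the branch vertices of a subdivided
complete graph. -/
lemma hasCompleteMinorIn_of_common_nbrs {R : Finset V} (hRS : R ⊆ S)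
    (hR : ∀ x ∈ R, ∀ y ∈ R, x ≠ y →
      R.card * R.card + R.card ≤ (G.nbrsIn S x ∩ G.nbrsIn S y).card) :
    G.HasCompleteMinorIn S R.card := by
  set t := R.card with ht
  let e : Fin t ≃ R := R.equivFin.symm
  let A : {p : Fin t × Fin t // p.1 ≠ p.2} → Finset V := fun p =>
    (G.nbrsIn S (e p.1.1) ∩ G.nbrsIn S (e p.1.2)) \ R
  have he : ∀ i j, i ≠ j → (e i : V) ≠ e j := fun i j hij h => hij (e.injective (Subtype.ext h))
  obtain ⟨c, hcinj, hc⟩ : ∃ c : {p : Fin t × Fin t // p.1 ≠ p.2} → V,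
      Function.Injective c ∧ ∀ p, c p ∈ A p := by
    rw [← Finset.all_card_le_biUnion_card_iff_exists_injective]
    intro s
    rcases s.eq_empty_or_nonempty with rfl | ⟨p, hp⟩
    · simp
    calc s.card ≤ Fintype.card {p : Fin t × Fin t // p.1 ≠ p.2} := Finset.card_le_univ s
      _ ≤ Fintype.card (Fin t × Fin t) := Fintype.card_subtype_le _
      _ = t * t := by simp
      _ ≤ (A p).card := by
        have := Finset.le_card_sdiff R (G.nbrsIn S (e p.1.1) ∩ G.nbrsIn S (e p.1.2))
        have := hR _ (e p.1.1).2 _ (e p.1.2).2 (he _ _ p.2)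
        change t * t ≤ ((G.nbrsIn S (e p.1.1) ∩ G.nbrsIn S (e p.1.2)) \ R).card
        omega
      _ ≤ _ := Finset.card_le_card (Finset.subset_biUnion_of_mem A hp)
  have hc1 : ∀ p, c p ∈ S ∧ G.Adj (e p.1.1) (c p) ∧ G.Adj (e p.1.2) (c p) ∧ c p ∉ R := by
    intro p
    have := hc p
    simp only [A, Finset.mem_sdiff, Finset.mem_inter, mem_nbrsIn] at this
    exact ⟨this.1.1.1, this.1.1.2, this.1.2.2, this.2⟩
  let f : Fin t → Set V := fun i => insert (e i : V) {x | ∃ p, p.1.1 = i ∧ c p = x}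
  refine ⟨f, fun i => ?_, fun i => ⟨e i, Set.mem_insert _ _⟩, fun i => ?_, fun i j hij => ?_,
    fun i j hij => ?_⟩
  · rintro x (rfl | ⟨p, -, rfl⟩)
    · exact hRS (e i).2
    · exact (hc1 p).1
  · rw [connected_iff_exists_forall_reachable]
    refine ⟨⟨e i, Set.mem_insert _ _⟩, ?_⟩
    rintro ⟨x, rfl | ⟨p, rfl, rfl⟩⟩
    · exact Reachable.rfl
    · exact Adj.reachable (by simpa using (hc1 p).2.1)
  · refine Set.disjoint_left.2 ?_
    rintro x (rfl | ⟨p, rfl, rfl⟩) (hx | ⟨p', rfl, hx⟩)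
    · exact he _ _ hij hx
    · exact (hc1 p').2.2.2 (hx ▸ (e i).2)
    · exact (hc1 p).2.2.2 (hx ▸ (e j).2)
    · exact hij (by rw [hcinj hx])
  · exact ⟨c ⟨(i, j), hij⟩, Or.inr ⟨_, rfl, rfl⟩, e j, Set.mem_insert _ _,
      (hc1 ⟨(i, j), hij⟩).2.2.1.symm⟩

/-- A large set in which every vertex has about half of the set as neighbours hosts a
`K_t`-minor. -/
lemma hasCompleteMinorIn_of_card_le_two_mul (t : ℕ) (ht : 6 * (t * t + t) + 3 ≤ S.card)
    (hdeg : ∀ v ∈ S, S.card ≤ 2 * (G.nbrsIn S v).card + 1) : G.HasCompleteMinorIn S t := by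
  obtain ⟨R, hRS, hRt, hR⟩ := exists_pairwise_of_three (A := S) t
    (r := fun x y => t * t + t ≤ (G.nbrsIn S x ∩ G.nbrsIn S y).card)
    (fun x hx y hy z hz _ _ _ => by
      by_contra hcon
      push Not at hcon
      have h1 := Finset.card_union_add_card_inter (G.nbrsIn S x) (G.nbrsIn S y)
      have h2 := Finset.card_union_add_card_inter (G.nbrsIn S x ∪ G.nbrsIn S y) (G.nbrsIn S z)
      have h3 : ((G.nbrsIn S x ∪ G.nbrsIn S y) ∩ G.nbrsIn S z).card ≤
          (G.nbrsIn S x ∩ G.nbrsIn S z).card + (G.nbrsIn S y ∩ G.nbrsIn S z).card := by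
        rw [Finset.union_inter_distrib_right]
        exact Finset.card_union_le _ _
      have h4 : (G.nbrsIn S x ∪ G.nbrsIn S y ∪ G.nbrsIn S z).card ≤ S.card :=
        Finset.card_le_card (Finset.union_subset (Finset.union_subset (nbrsIn_subset x)
          (nbrsIn_subset y)) (nbrsIn_subset z))
      have := hdeg x hx
      have := hdeg y hy
      have := hdeg z hz
      omega)
    (fun x y h => by rwa [Finset.inter_comm]) (by nlinarith)
  subst hRt
  exact hasCompleteMinorIn_of_common_nbrs hRS hR

/-- The graph obtained by contracting the edge `uv` into `u`, leaving `v` isolated. -/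
def contractInto (G : SimpleGraph V) (u v : V) : SimpleGraph V where
  Adj x y := x ≠ y ∧ x ≠ v ∧ y ≠ v ∧
    (G.Adj x y ∨ (x = u ∧ G.Adj v y) ∨ (y = u ∧ G.Adj v x))
  symm := ⟨fun x y h => ⟨h.1.symm, h.2.2.1, h.2.1, by
    rcases h.2.2.2 with h | h | h
    · exact Or.inl h.symm
    · exact Or.inr (Or.inr h)
    · exact Or.inr (Or.inl h)⟩⟩
  loopless := ⟨fun x h => h.1 rfl⟩

/-- The ordered pairs of adjacent vertices of `S`. -/
noncomputable def dartsIn (G : SimpleGraph V) (S : Finset V) : Finset (V × V) :=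
  (S ×ˢ S).filter fun p => G.Adj p.1 p.2

lemma mem_dartsIn {x y : V} : (x, y) ∈ G.dartsIn S ↔ (x ∈ S ∧ y ∈ S) ∧ G.Adj x y := by
  simp [dartsIn]

lemma card_dartsIn_eq_sum : (G.dartsIn S).card = ∑ v ∈ S, (G.nbrsIn S v).card := by
  simp only [dartsIn, nbrsIn, Finset.card_filter, Finset.sum_product]

lemma card_dartsIn_le_contractInto {u v : V} (hu : u ∈ S) (huv : G.Adj u v) :
    (G.dartsIn S).card ≤ ((G.contractInto u v).dartsIn (S.erase v)).card +
      2 * ((G.nbrsIn S u ∩ G.nbrsIn S v).card + 1) := by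
  set W := insert u (G.nbrsIn S u ∩ G.nbrsIn S v)
  have hW : ∀ x, x ∈ W ↔ x = u ∨ (x ∈ S ∧ G.Adj u x) ∧ x ∈ S ∧ G.Adj v x := fun x => by
    simp [W, mem_nbrsIn]
  have hWcard : W.card ≤ (G.nbrsIn S u ∩ G.nbrsIn S v).card + 1 := Finset.card_insert_le _ _
  have hlost : (W ×ˢ {v} ∪ {v} ×ˢ W).card ≤ 2 * W.card := by
    refine (Finset.card_union_le _ _).trans ?_
    simp only [Finset.card_product, Finset.card_singleton]
    omega
  have hkept : (G.dartsIn S \ (W ×ˢ {v} ∪ {v} ×ˢ W)).card ≤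
      ((G.contractInto u v).dartsIn (S.erase v)).card := by
    refine Finset.card_le_card_of_injOn
      (fun p => (if p.1 = v then u else p.1, if p.2 = v then u else p.2)) ?_ ?_
    · rintro ⟨x, y⟩ h
      simp only [Finset.coe_sdiff, Set.mem_sdiff, Finset.mem_coe, mem_dartsIn, Finset.mem_union,
        Finset.mem_product, Finset.mem_singleton, hW] at h
      simp only [Finset.mem_coe, mem_dartsIn, Finset.mem_erase, contractInto]
      have hne := huv.ne
      have hxy := h.1.2.ne
      have hsymm := G.adj_comm x y
      split_ifs <;> grind [SimpleGraph.adj_comm]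
    · rintro ⟨x, y⟩ h ⟨x', y'⟩ h' heq
      simp only [Finset.coe_sdiff, Set.mem_sdiff, Finset.mem_coe, mem_dartsIn, Finset.mem_union,
        Finset.mem_product, Finset.mem_singleton, hW] at h h'
      simp only [Prod.mk.injEq] at heq ⊢
      have hxy := h.1.2.ne
      have hxy' := h'.1.2.ne
      grind [SimpleGraph.adj_comm]
  have := Finset.le_card_sdiff (W ×ˢ {v} ∪ {v} ×ˢ W) (G.dartsIn S)
  omega

lemma HasCompleteMinorIn.of_contractInto {u v : V} (hv : v ∈ S)
    (huv : G.Adj u v) {t : ℕ} (h : (G.contractInto u v).HasCompleteMinorIn (S.erase v) t) :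
    G.HasCompleteMinorIn S t := by
  obtain ⟨f, hsub, hne, hconn, hdisj, hadj⟩ := h
  have hsub' : ∀ i x, x ∈ f i → x ≠ v ∧ x ∈ S := fun i x hx =>
    Finset.mem_erase.1 (hsub i hx)
  let g : Fin t → Set V := fun i => {x | x ∈ f i ∨ (x = v ∧ u ∈ f i)}
  have hfg : ∀ i x, x ∈ f i → x ∈ g i := fun i x hx => Or.inl hx
  refine ⟨g, fun i => ?_, fun i => (hne i).mono (hfg i), fun i => ?_, fun i j hij => ?_,
    fun i j hij => ?_⟩
  · rintro x (hx | ⟨rfl, -⟩)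
    · exact (hsub' i x hx).2
    · exact hv
  · have hstep : ∀ x y : f i, ((G.contractInto u v).induce (f i)).Adj x y →
        (G.induce (g i)).Reachable ⟨x, hfg i x x.2⟩ ⟨y, hfg i y y.2⟩ := by
      rintro ⟨x, hx⟩ ⟨y, hy⟩ ⟨-, -, -, h | ⟨rfl, h⟩ | ⟨rfl, h⟩⟩
      · exact Adj.reachable (by simpa using h)
      · have h1 : (G.induce (g i)).Adj ⟨x, hfg i x hx⟩ ⟨v, Or.inr ⟨rfl, hx⟩⟩ := huv
        have h2 : (G.induce (g i)).Adj ⟨v, Or.inr ⟨rfl, hx⟩⟩ ⟨y, hfg i y hy⟩ := h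
        exact h1.reachable.trans h2.reachable
      · have h1 : (G.induce (g i)).Adj ⟨x, hfg i x hx⟩ ⟨v, Or.inr ⟨rfl, hy⟩⟩ := h.symm
        have h2 : (G.induce (g i)).Adj ⟨v, Or.inr ⟨rfl, hy⟩⟩ ⟨y, hfg i y hy⟩ := huv.symm
        exact h1.reachable.trans h2.reachable
    have hreach : ∀ x y : f i,
        (G.induce (g i)).Reachable ⟨x, hfg i x x.2⟩ ⟨y, hfg i y y.2⟩ := by
      intro x y
      have := (hconn i).preconnected x y
      rw [reachable_iff_reflTransGen] at this
      induction this with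
      | refl => exact Reachable.rfl
      | tail _ hadj ih => exact ih.trans (hstep _ _ hadj)
    obtain ⟨x₀, hx₀⟩ := hne i
    rw [connected_iff_exists_forall_reachable]
    refine ⟨⟨x₀, hfg i x₀ hx₀⟩, ?_⟩
    rintro ⟨y, hy | ⟨rfl, hu⟩⟩
    · exact hreach ⟨x₀, hx₀⟩ ⟨y, hy⟩
    · have h1 : (G.induce (g i)).Adj ⟨u, hfg i u hu⟩ ⟨y, Or.inr ⟨rfl, hu⟩⟩ := huv
      exact (hreach ⟨x₀, hx₀⟩ ⟨u, hu⟩).trans h1.reachable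
  · have hd := Set.disjoint_left.1 (hdisj hij)
    refine Set.disjoint_left.2 ?_
    rintro x (hx | ⟨rfl, hx⟩) (hx' | ⟨h, hx'⟩)
    · exact hd hx hx'
    · exact (hsub' i x hx).1 h
    · exact (hsub' j x hx').1 rfl
    · exact hd hx hx'
  · obtain ⟨x, hx, y, hy, -, -, -, h | ⟨rfl, h⟩ | ⟨rfl, h⟩⟩ := hadj i j hij
    · exact ⟨x, hfg i x hx, y, hfg j y hy, h⟩
    · exact ⟨v, Or.inr ⟨rfl, hx⟩, y, hfg j y hy, h⟩
    · exact ⟨x, hfg i x hx, v, Or.inr ⟨rfl, hy⟩, h.symm⟩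

/-- A graph of average degree at least quadratic in `t` has a `K_t`-minor. -/
lemma hasCompleteMinorIn_of_card_dartsIn (t k : ℕ) (hk : 6 * (t * t + t) + 3 ≤ k)
    (hS : S.Nonempty) (h : 2 * k * S.card ≤ (G.dartsIn S).card) : G.HasCompleteMinorIn S t := by
  induction hn : S.card using Nat.strong_induction_on generalizing S G with
  | _ n ih =>
    subst hn
    have hpos : 0 < S.card := hS.card_pos
    have hnonempty : ∀ {v}, v ∈ S → (∃ p, p ∈ G.dartsIn S) → (S.erase v).Nonempty := by
      rintro v hv ⟨⟨x, y⟩, hp⟩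
      rw [mem_dartsIn] at hp
      by_cases hx : x = v
      · exact ⟨y, Finset.mem_erase.2 ⟨fun hy => hp.2.ne (hx.trans hy.symm), hp.1.2⟩⟩
      · exact ⟨x, Finset.mem_erase.2 ⟨hx, hp.1.1⟩⟩
    have hdart : ∃ p, p ∈ G.dartsIn S := Finset.card_pos.1 (by nlinarith)
    by_cases hcontract : ∃ u ∈ S, ∃ v ∈ S, G.Adj u v ∧
        2 * ((G.nbrsIn S u ∩ G.nbrsIn S v).card + 1) * S.card ≤ (G.dartsIn S).card
    · obtain ⟨u, hu, v, hv, huv, hle⟩ := hcontract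
      have hcard := Finset.card_erase_add_one hv
      refine HasCompleteMinorIn.of_contractInto hv huv
        (ih _ (by omega) (hnonempty hv hdart) ?_ rfl)
      have hdarts := card_dartsIn_le_contractInto hu huv
      set c := 2 * ((G.nbrsIn S u ∩ G.nbrsIn S v).card + 1)
      set E := (G.dartsIn S).card
      set E' := ((G.contractInto u v).dartsIn (S.erase v)).card
      set n := (S.erase v).card
      rw [← hcard] at hle h
      refine le_of_mul_le_mul_right (a := n + 1) ?_ (by omega)
      have h1 : E * (n + 1) ≤ (E' + c) * (n + 1) := by gcongr
      have h2 : 2 * k * (n + 1) * n ≤ E * n := by gcongr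
      nlinarith
    push Not at hcontract
    by_cases hiso : ∃ v ∈ S, G.nbrsIn S v = ∅
    · obtain ⟨v, hv, hempty⟩ := hiso
      have hcard := Finset.card_erase_add_one hv
      refine (ih _ (by omega) (hnonempty hv hdart) ?_ rfl).mono (Finset.erase_subset v S)
      have hsub : G.dartsIn S ⊆ G.dartsIn (S.erase v) := by
        rintro ⟨x, y⟩ hxy
        rw [mem_dartsIn] at hxy ⊢
        have hno : ∀ w ∈ S, ¬ G.Adj v w := fun w hw hvw => by
          simpa [hempty] using mem_nbrsIn.2 ⟨hw, hvw⟩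
        refine ⟨⟨Finset.mem_erase.2 ⟨?_, hxy.1.1⟩, Finset.mem_erase.2 ⟨?_, hxy.1.2⟩⟩, hxy.2⟩
        · rintro rfl; exact hno y hxy.1.2 hxy.2
        · rintro rfl; exact hno x hxy.1.1 hxy.2.symm
      have := Finset.card_le_card hsub
      nlinarith
    push Not at hiso
    obtain ⟨v, hv, hmin⟩ := Finset.exists_min_image S (fun v => (G.nbrsIn S v).card) hS
    have hdeg : (G.nbrsIn S v).card * S.card ≤ (G.dartsIn S).card := by
      rw [card_dartsIn_eq_sum, mul_comm, ← smul_eq_mul]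
      exact Finset.card_nsmul_le_sum _ _ _ hmin
    have hcommon : ∀ u ∈ G.nbrsIn S v,
        (G.nbrsIn (G.nbrsIn S v) u) = G.nbrsIn S u ∩ G.nbrsIn S v := fun u _ => by
      ext x
      simp only [mem_nbrsIn, Finset.mem_inter]
      tauto
    have hlt : ∀ u ∈ G.nbrsIn S v,
        (G.dartsIn S).card < 2 * ((G.nbrsIn (G.nbrsIn S v) u).card + 1) * S.card := by
      intro u hu
      rw [hcommon u hu]
      have := mem_nbrsIn.1 hu
      exact hcontract u this.1 v hv this.2.symm
    refine (hasCompleteMinorIn_of_card_le_two_mul (S := G.nbrsIn S v) t ?_ ?_).mono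
      (nbrsIn_subset v)
    · obtain ⟨u, hu⟩ := hiso v hv
      have h1 := hlt u hu
      have h2 := card_nbrsIn_lt (G := G) hu
      have h3 : k < (G.nbrsIn (G.nbrsIn S v) u).card + 1 := by
        refine lt_of_mul_lt_mul_right (a := 2 * S.card) ?_ (by omega)
        nlinarith
      omega
    · intro u hu
      have := lt_of_mul_lt_mul_right (hdeg.trans_lt (hlt u hu)) (by omega)
      omega

lemma exists_card_nbrsIn_lt (t k : ℕ) (hk : 6 * (t * t + t) + 3 ≤ k) (hS : S.Nonempty)
    (hminor : ¬ G.HasCompleteMinorIn S t) : ∃ v ∈ S, (G.nbrsIn S v).card < 2 * k := by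
  by_contra hcon
  push Not at hcon
  refine hminor (hasCompleteMinorIn_of_card_dartsIn t k hk hS ?_)
  rw [card_dartsIn_eq_sum, mul_comm, ← smul_eq_mul]
  exact Finset.card_nsmul_le_sum _ _ _ hcon

/-! ### The clique count -/

lemma card_cliquesIn_le_of_forall_small (t k : ℕ) (hk : 6 * (t * t + t) + 3 ≤ k) (B : ℝ)
    (hB : ∀ T ⊆ S, T.card < 2 * k → ((G.cliquesIn T).card : ℝ) ≤ B)
    (hminor : ¬ G.HasCompleteMinorIn S t) :
    ((G.cliquesIn S).card : ℝ) ≤ B * S.card + 1 := by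
  induction hn : S.card generalizing S with
  | zero =>
    rw [Finset.card_eq_zero] at hn
    subst hn
    simp [card_cliquesIn_empty]
  | succ n ih =>
    obtain ⟨v, hv, hlt⟩ := exists_card_nbrsIn_lt t k hk
      (Finset.card_pos.1 (by omega)) hminor
    have hsub := Finset.erase_subset v S
    have h1 := ih (fun T hT => hB T (hT.trans hsub)) (fun h => hminor (h.mono hsub))
      (by rw [Finset.card_erase_of_mem hv, hn]; rfl)
    have h2 := hB _ (nbrsIn_subset v) hlt
    have h3 : ((G.cliquesIn S).card : ℝ) ≤ (G.cliquesIn (S.erase v)).card +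
      (G.cliquesIn (G.nbrsIn S v)).card := by exact_mod_cast card_cliquesIn_le_erase_add v
    push_cast
    linarith

lemma cliqueCount_eq_card_cliquesIn [Fintype V] :
    G.cliqueCount = (G.cliquesIn Finset.univ).card := by
  rw [cliqueCount, Nat.card_eq_fintype_card, Fintype.card_subtype]
  congr 1

lemma card_cliquesIn_le_of_dense (q h t : ℕ) (hq0 : 0 < q) (hh : 2 ≤ h)
    (hq : h ^ 2 * (q + 2 * t) ≤ q ^ 2)
    (hT : ∀ v ∈ T, (T.card - (G.nbrsIn T v).card) * q ≤ T.card)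
    (hminor : ¬ G.HasCompleteMinorIn T t) :
    ((G.cliquesIn T).card : ℝ) ≤ (3 : ℝ) ^ ((2 * t + 4 / h * t : ℝ) / 3) := by
  obtain ⟨K, hK, hmax⟩ := Finset.exists_max_image (G.cliquesIn T) Finset.card
    ⟨∅, mem_cliquesIn.2 (by simp)⟩
  refine (card_cliquesIn_le_of_forall_card_le K.card hmax).trans
    (Real.rpow_le_rpow_of_exponent_le (by norm_num) ?_)
  have hle := card_add_card_le_of_not_hasCompleteMinorIn q h t hq0 hq hT hK hminor
  have hcard : T.card ≤ 4 * t := by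
    refine le_of_mul_le_mul_right (a := h) ?_ (by omega)
    nlinarith
  have hle' : (T.card + K.card) * h ≤ 2 * t * h + 4 * t := by nlinarith
  have hpos : (0 : ℝ) < h := by exact_mod_cast (by omega : 0 < h)
  gcongr
  refine le_of_mul_le_mul_right ?_ hpos
  have : ((T.card + K.card : ℕ) : ℝ) * h ≤ 2 * t * h + 4 * t := by exact_mod_cast hle'
  refine this.trans (le_of_eq ?_)
  field_simp

lemma two_pow_mul_pow_le (p l : ℕ) : 2 ^ l * p ^ ((p + 1) * l) ≤ (p + 1) ^ ((p + 1) * l) := by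
  rw [pow_mul, pow_mul, ← mul_pow]
  refine Nat.pow_le_pow_left ?_ l
  have hbern : ∀ n : ℕ, p ^ (n + 1) + (n + 1) * p ^ n ≤ (p + 1) ^ (n + 1) := by
    intro n
    induction n with
    | zero => simp
    | succ n ih =>
      calc p ^ (n + 1 + 1) + (n + 1 + 1) * p ^ (n + 1)
          ≤ (p ^ (n + 1) + (n + 1) * p ^ n) * (p + 1) := by
            have : 0 ≤ (n + 1) * p ^ n := by positivity
            rw [pow_succ p (n + 1), pow_succ p n]
            nlinarith
        _ ≤ (p + 1) ^ (n + 1) * (p + 1) := by gcongr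
        _ = _ := (pow_succ _ _).symm
  calc 2 * p ^ (p + 1) = p ^ (p + 1) + p * p ^ p := by ring
    _ ≤ p ^ (p + 1) + (p + 1) * p ^ p := by gcongr; omega
    _ ≤ _ := hbern p

lemma card_cliquesIn_le_of_not_hasCompleteMinorIn (q h t l : ℕ) (hq2 : 2 ≤ q) (hh : 2 ≤ h)
    (hq : h ^ 2 * (q + 2 * t) ≤ q ^ 2) (ht : 1 ≤ t) (hl : 30 * t ^ 2 + 1 ≤ 2 ^ l)
    (hS : S.Nonempty) (hminor : ¬ G.HasCompleteMinorIn S t) :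
    ((G.cliquesIn S).card : ℝ) ≤
      (3 : ℝ) ^ ((2 * t + 4 / h * t : ℝ) / 3) * 2 ^ (q * l ^ 2 + 1) * S.card := by
  obtain ⟨p, rfl⟩ : ∃ p, q = p + 1 := ⟨q - 1, by omega⟩
  set B := (3 : ℝ) ^ ((2 * t + 4 / h * t : ℝ) / 3)
  have hB : 1 ≤ B := Real.one_le_rpow (by norm_num) (by positivity)
  have hsmall : ∀ T ⊆ S, T.card < 2 * (15 * t ^ 2) →
      ((G.cliquesIn T).card : ℝ) ≤ B * 2 ^ ((p + 1) * l ^ 2) := by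
    intro T hTS hT
    have hpeel := card_cliquesIn_le_mul_pow (G := G) (S := T) p (30 * t ^ 2) B (by linarith) S
      (fun U hU hdense => card_cliquesIn_le_of_dense (p + 1) h t (by omega) hh hq hdense
        fun hm => hminor (hm.mono hU)) ((p + 1) * l) hTS (by omega)
      (lt_of_lt_of_le (Nat.mul_lt_mul_of_pos_right (by omega : T.card < 2 ^ l)
        (Nat.pow_pos (by omega))) (two_pow_mul_pow_le p l))
    refine hpeel.trans ?_
    gcongr
    calc (((30 * t ^ 2 : ℕ) : ℝ) + 1) ^ ((p + 1) * l) ≤ ((2 : ℝ) ^ l) ^ ((p + 1) * l) := by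
          gcongr
          exact_mod_cast hl
      _ = _ := by
          rw [← pow_mul]
          ring
  have hcount := card_cliquesIn_le_of_forall_small t (15 * t ^ 2) (by nlinarith) _ hsmall hminor
  have hcard : (1 : ℝ) ≤ S.card := by exact_mod_cast hS.card_pos
  have hC : 1 ≤ B * 2 ^ ((p + 1) * l ^ 2) :=
    one_le_mul_of_one_le_of_one_le hB (one_le_pow₀ (by norm_num))
  rw [pow_succ]
  nlinarith

end

/-- The subexponential loss in the clique count: `√t (log t) ^ 2 = o(t)`. -/
lemma eventually_loss_le (ε : ℝ) (hε : 0 < ε) (h : ℕ) :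
    ∀ᶠ t : ℕ in Filter.atTop,
      ((2 * h ^ 2 * (Nat.sqrt t + 1) * (2 * Nat.log 2 t + 7) ^ 2 + 1 : ℕ) : ℝ) ≤ ε * t := by
  set c : ℝ := ε / (2 * (4 * h ^ 2 * 121 + 1)) with hc
  have hden : (0 : ℝ) < 4 * h ^ 2 * 121 + 1 := by positivity
  have hcpos : 0 < c := by positivity
  have hlog := (tendsto_natCast_atTop_atTop (R := ℝ)).eventually
    ((isLittleO_log_rpow_atTop (r := 1 / 4) (by norm_num)).bound (Real.sqrt_pos.2 hcpos))
  filter_upwards [hlog, Filter.eventually_ge_atTop 3,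
    (tendsto_natCast_atTop_atTop (R := ℝ)).eventually_ge_atTop (2 / ε)] with t hlt ht htε
  have ht3 : (3 : ℝ) ≤ t := by exact_mod_cast ht
  have ht0 : (0 : ℝ) ≤ t := by linarith
  have hlog1 : 1 ≤ Real.log t := by
    rw [Real.le_log_iff_exp_le (by linarith)]
    linarith [Real.exp_one_lt_d9]
  have hsqlog : Real.log t ^ 2 ≤ c * √t := by
    rw [Real.norm_of_nonneg (by linarith), Real.norm_of_nonneg (by positivity)] at hlt
    calc Real.log t ^ 2 ≤ (√c * (t : ℝ) ^ (1 / 4 : ℝ)) ^ 2 := by gcongr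
      _ = c * √t := by
        rw [mul_pow, Real.sq_sqrt hcpos.le, ← Real.rpow_natCast ((t : ℝ) ^ (1 / 4 : ℝ)),
          ← Real.rpow_mul ht0, Real.sqrt_eq_rpow]
        norm_num
  have hnatlog : (Nat.log 2 t : ℝ) ≤ 2 * Real.log t := by
    have h1 : (Nat.log 2 t : ℝ) ≤ Real.logb 2 t := by
      exact_mod_cast Real.natLog_le_logb t 2
    have h2 : Real.logb 2 t * Real.log 2 = Real.log t := by
      rw [Real.logb, div_mul_cancel₀ _ (by positivity)]
    nlinarith [Real.log_two_gt_d9, Nat.cast_nonneg (α := ℝ) (Nat.log 2 t)]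
  have hl : (2 * (Nat.log 2 t : ℝ) + 7) ^ 2 ≤ 121 * (c * √t) := by
    calc (2 * (Nat.log 2 t : ℝ) + 7) ^ 2 ≤ (11 * Real.log t) ^ 2 := by
          gcongr
          linarith
      _ = 121 * Real.log t ^ 2 := by ring
      _ ≤ _ := by gcongr
  have hsqrt1 : 1 ≤ √(t : ℝ) := Real.one_le_sqrt.2 (by linarith)
  have hsqrt : (Nat.sqrt t : ℝ) + 1 ≤ 2 * √t := by
    linarith [Real.nat_sqrt_le_real_sqrt (a := t)]
  have hone : 1 ≤ ε / 2 * t := by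
    have := (div_le_iff₀ hε).1 htε
    linarith
  push_cast
  calc (2 * (h : ℝ) ^ 2 * (Nat.sqrt t + 1) * (2 * Nat.log 2 t + 7) ^ 2 + 1)
      ≤ 2 * (h : ℝ) ^ 2 * (2 * √t) * (121 * (c * √t)) + ε / 2 * t := by gcongr
    _ = 4 * h ^ 2 * 121 * c * (√t * √t) + ε / 2 * t := by ring
    _ = 4 * h ^ 2 * 121 * c * t + ε / 2 * t := by rw [Real.mul_self_sqrt ht0]
    _ ≤ (4 * h ^ 2 * 121 + 1) * c * t + ε / 2 * t := by gcongr; linarith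
    _ = ε * t := by
      rw [hc]
      field_simp
      ring

end SimpleGraph

/-- Every graph on `n` vertices with no `K_t`-minor has at most `3 ^ ((2/3 + ε) t) * n`
cliques, for `t` sufficiently large. -/
theorem clique_count_of_no_complete_minor (ε : ℝ) (hε : 0 < ε) :
    ∃ t₀ : ℕ, ∀ t : ℕ, t₀ ≤ t → ∀ n : ℕ, 0 < n →
      ∀ (V : Type) [Fintype V], Fintype.card V = n →
        ∀ G : SimpleGraph V, ¬ (SimpleGraph.completeGraph (Fin t)).IsMinor G →
          (G.cliqueCount : ℝ) ≤ 3 ^ ((2 / 3 + ε) * t) * n := by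
  set h : ℕ := ⌈4 / ε⌉₊ + 2
  have hh : 4 / (h : ℝ) ≤ ε := by
    have h1 : 4 / ε ≤ h := (Nat.le_ceil _).trans (by simp [h])
    rw [div_le_iff₀ (by positivity)] at h1 ⊢
    linarith
  obtain ⟨t₀, ht₀⟩ := Filter.eventually_atTop.1
    (SimpleGraph.eventually_loss_le (2 / 3 * ε) (by positivity) h)
  refine ⟨max t₀ 1, fun t ht n hn V _ hV G hG => ?_⟩
  have ht1 : 1 ≤ t := (le_max_right _ _).trans ht
  set r := Nat.sqrt t + 1
  set l := 2 * Nat.log 2 t + 7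
  have hloss : ((2 * h ^ 2 * r * l ^ 2 + 1 : ℕ) : ℝ) ≤ 2 / 3 * ε * t :=
    ht₀ t ((le_max_left _ _).trans ht)
  have hr : t ≤ r ^ 2 := (Nat.lt_succ_sqrt' t).le
  have hq : h ^ 2 * (2 * h ^ 2 * r + 2 * t) ≤ (2 * h ^ 2 * r) ^ 2 := by
    have h1 : r ≤ r ^ 2 := Nat.le_self_pow (by norm_num) r
    have h2 : h ^ 2 ≤ h ^ 2 * h ^ 2 := Nat.le_mul_self _
    calc h ^ 2 * (2 * h ^ 2 * r + 2 * t) = 2 * (h ^ 2 * h ^ 2) * r + 2 * h ^ 2 * t := by ring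
      _ ≤ 2 * (h ^ 2 * h ^ 2) * r ^ 2 + 2 * (h ^ 2 * h ^ 2) * r ^ 2 := by gcongr
      _ = _ := by ring
  have hl : 30 * t ^ 2 + 1 ≤ 2 ^ l := by
    have h1 : t ≤ 2 ^ (Nat.log 2 t + 1) := (Nat.lt_pow_succ_log_self (by norm_num) t).le
    calc 30 * t ^ 2 + 1 ≤ t ^ 2 * 2 ^ 5 := by nlinarith
      _ ≤ (2 ^ (Nat.log 2 t + 1)) ^ 2 * 2 ^ 5 := by gcongr
      _ = 2 ^ l := by
        rw [← pow_mul, ← pow_add]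
        congr 1
        simp only [l]
        ring
  have hS : (Finset.univ : Finset V).Nonempty := by
    rw [← Finset.card_pos, Finset.card_univ, hV]
    exact hn
  have hcount := SimpleGraph.card_cliquesIn_le_of_not_hasCompleteMinorIn (2 * h ^ 2 * r) h t l
    (by have : 0 < h ^ 2 * r := by positivity
        nlinarith) (by simp [h]) hq ht1 hl hS
    fun hm => hG hm.isMinor
  rw [SimpleGraph.cliqueCount_eq_card_cliquesIn]
  refine hcount.trans ?_
  rw [Finset.card_univ, hV]
  gcongr
  calc (3 : ℝ) ^ ((2 * t + 4 / h * t : ℝ) / 3) * 2 ^ (2 * h ^ 2 * r * l ^ 2 + 1)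
      ≤ (3 : ℝ) ^ ((2 * t + ε * t) / 3) * (3 : ℝ) ^ (2 / 3 * ε * t) := by
        gcongr
        · norm_num
        · rw [← Real.rpow_natCast]
          exact (Real.rpow_le_rpow (by norm_num) (by norm_num) (by positivity)).trans
            (Real.rpow_le_rpow_of_exponent_le (by norm_num) hloss)
    _ = (3 : ℝ) ^ ((2 / 3 + ε) * t) := by
        rw [← Real.rpow_add (by norm_num)]
        congr 1
        ring
end

section
/- For every ε > 0 there exists t₀ such that for every integer t ≥ t₀ and every integer n ≥ 4t/3, there exists a simple graph on n vertices with no K_t-minor that has at least 3^{(2/3−ε)t} · n cliques. -/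
namespace SimpleGraph

/-- The graph on `Fin n` whose vertices are grouped into consecutive blocks of `2 * k` vertices,
each block inducing the complement of the perfect matching `{2 * i, 2 * i + 1}`. -/
def cocktailPartyUnion (k n : ℕ) : SimpleGraph (Fin n) where
  Adj v w := (v : ℕ) / (2 * k) = w / (2 * k) ∧ (v : ℕ) / 2 ≠ w / 2
  symm := ⟨fun _ _ h => ⟨h.1.symm, h.2.symm⟩⟩
  loopless := ⟨fun _ h => h.2 rfl⟩

variable {k n : ℕ}

theorem cocktailPartyUnion_div_eq_of_reachable {v w : Fin n}
    (h : (cocktailPartyUnion k n).Reachable v w) : (v : ℕ) / (2 * k) = w / (2 * k) := by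
  obtain ⟨p⟩ := h
  induction p with
  | nil => rfl
  | cons h _ ih => exact h.1.trans ih

/-- The branch sets of a complete minor all lie in a single block. -/
theorem cocktailPartyUnion_div_eq_of_minor {t : ℕ} {f : Fin t → Set (Fin n)}
    (hconn : ∀ a, ((cocktailPartyUnion k n).induce (f a)).Connected)
    (hadj : ∀ a b, a ≠ b → ∃ v ∈ f a, ∃ w ∈ f b, (cocktailPartyUnion k n).Adj v w)
    {a b : Fin t} {v w : Fin n} (hv : v ∈ f a) (hw : w ∈ f b) :
    (v : ℕ) / (2 * k) = w / (2 * k) := by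
  have hsame : ∀ (c : Fin t) {x y : Fin n}, x ∈ f c → y ∈ f c →
      (x : ℕ) / (2 * k) = y / (2 * k) := fun c x y hx hy =>
    cocktailPartyUnion_div_eq_of_reachable
      (((hconn c).preconnected ⟨x, hx⟩ ⟨y, hy⟩).map (Embedding.induce (f c)).toHom)
  by_cases hab : a = b
  · subst hab
    exact hsame a hv hw
  · obtain ⟨x, hx, y, hy, hxy⟩ := hadj a b hab
    exact (hsame a hv hx).trans (hxy.1.trans (hsame b hy hw))

theorem not_completeGraph_isMinor_cocktailPartyUnion {t : ℕ} (hk : 0 < k) (hkt : 3 * k < 2 * t) :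
    ¬ (SimpleGraph.completeGraph (Fin t)).IsMinor (cocktailPartyUnion k n) := by
  classical
  rintro ⟨f, hne, hconn, hdisj, hadj'⟩
  have hadj : ∀ a b, a ≠ b → ∃ v ∈ f a, ∃ w ∈ f b, (cocktailPartyUnion k n).Adj v w :=
    fun a b hab => hadj' hab
  have ht : 0 < t := by omega
  choose p hp using hne
  obtain ⟨c, hc⟩ : ∃ c : ℕ, ∀ a, ∀ v ∈ f a, (v : ℕ) / (2 * k) = c :=
    ⟨(p ⟨0, ht⟩ : ℕ) / (2 * k), fun a v hv =>
      cocktailPartyUnion_div_eq_of_minor hconn hadj hv (hp ⟨0, ht⟩)⟩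
  have hrange : ∀ a, ∀ v ∈ f a, 2 * (c * k) ≤ (v : ℕ) ∧ (v : ℕ) < 2 * (c * k) + 2 * k := by
    intro a v hv
    have h := hc a v hv
    have h1 := Nat.div_add_mod (v : ℕ) (2 * k)
    have h2 := Nat.mod_lt (v : ℕ) (show 0 < 2 * k by omega)
    rw [h, show 2 * k * c = 2 * (c * k) by ring] at h1
    omega
  let F : Fin t → Finset (Fin n) := fun a => (f a).toFinset
  have hF : ∀ a v, v ∈ F a ↔ v ∈ f a := fun a v => Set.mem_toFinset
  have hpos : ∀ a, 0 < (F a).card := fun a => Finset.card_pos.2 ⟨p a, (hF a _).2 (hp a)⟩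
  have hsum : ∑ a, (F a).card ≤ 2 * k := by
    rw [← Finset.card_biUnion fun a _ b _ hab =>
      Set.disjoint_toFinset.2 (hdisj hab)]
    calc _ ≤ (Finset.Ico (2 * (c * k)) (2 * (c * k) + 2 * k)).card :=
          Finset.card_le_card_of_injOn (fun v : Fin n => (v : ℕ)) (fun v hv => by
            obtain ⟨a, -, ha⟩ := Finset.mem_biUnion.1 hv
            have := hrange a v ((hF a v).1 ha)
            simpa using this) (fun v _ w _ h => Fin.ext h)
      _ = 2 * k := by simp
  let S : Finset (Fin t) := {a | (F a).card = 1}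
  have hS : S.card ≤ k := by
    calc S.card ≤ (Finset.Ico (c * k) (c * k + k)).card :=
          Finset.card_le_card_of_injOn (fun a => (p a : ℕ) / 2) (fun a _ => by
            have := hrange a _ (hp a)
            simp only [Finset.coe_Ico, Set.mem_Ico]
            omega) (fun a ha b hb hab => by
            by_contra hne
            have huniq : ∀ a ∈ S, ∀ v ∈ f a, v = p a := fun a ha v hv =>
              Finset.card_le_one.1 (Finset.mem_filter.1 ha).2.le _ ((hF a v).2 hv) _
                ((hF a _).2 (hp a))
            obtain ⟨v, hv, w, hw, hvw⟩ := hadj a b hne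
            rw [huniq a ha v hv, huniq b hb w hw] at hvw
            exact hvw.2 hab)
      _ = k := by simp
  have hlow : ∑ a : Fin t, 2 ≤ ∑ a, ((F a).card + if a ∈ S then 1 else 0) := by
    refine Finset.sum_le_sum fun a _ => ?_
    have := hpos a
    by_cases ha : a ∈ S
    · simp only [ha, if_true]
      omega
    · have : (F a).card ≠ 1 := fun h => ha (Finset.mem_filter.2 ⟨Finset.mem_univ _, h⟩)
      simp only [ha, if_false]
      omega
  rw [Finset.sum_add_distrib, Finset.sum_ite_mem] at hlow
  simp only [Finset.univ_inter, Finset.sum_const, Finset.card_univ, Fintype.card_fin,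
    smul_eq_mul, mul_one] at hlow
  omega

/-- The vertices of the `i`-th block of `cocktailPartyUnion (K + 1) n` consisting of its first
vertex and, in the pair with index `j + 1`, the vertex chosen by `g j`, or none if `g j = 2`. -/
def blockTransversal {K : ℕ} (n i : ℕ) (g : Fin K → Fin 3) : Finset (Fin n) :=
  {v | (v : ℕ) = 2 * (i * (K + 1)) ∨
    ∃ j : Fin K, (g j : ℕ) < 2 ∧ (v : ℕ) = 2 * (i * (K + 1)) + 2 * j + 2 + g j}

theorem mem_blockTransversal {K i : ℕ} {g : Fin K → Fin 3} {v : Fin n} :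
    v ∈ blockTransversal n i g ↔ (v : ℕ) = 2 * (i * (K + 1)) ∨
      ∃ j : Fin K, (g j : ℕ) < 2 ∧ (v : ℕ) = 2 * (i * (K + 1)) + 2 * j + 2 + g j := by
  simp [blockTransversal]

theorem isClique_blockTransversal {K i : ℕ} (g : Fin K → Fin 3) :
    (cocktailPartyUnion (K + 1) n).IsClique (blockTransversal n i g : Set (Fin n)) := by
  intro v hv w hw hvw
  have hdiv : ∀ u ∈ blockTransversal n i g, (u : ℕ) / (2 * (K + 1)) = i := by
    intro u hu
    refine Nat.div_eq_of_lt_le ?_ ?_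
    · rw [mem_blockTransversal] at hu
      rw [show i * (2 * (K + 1)) = 2 * (i * (K + 1)) by ring]
      rcases hu with h | ⟨j, -, h⟩ <;> omega
    · rw [mem_blockTransversal] at hu
      rw [show (i + 1) * (2 * (K + 1)) = 2 * (i * (K + 1)) + 2 * K + 2 by ring]
      rcases hu with h | ⟨j, hj, h⟩ <;> omega
  refine ⟨(hdiv v hv).trans (hdiv w hw).symm, fun h => hvw (Fin.ext ?_)⟩
  rw [Finset.mem_coe, mem_blockTransversal] at hv hw
  rcases hv with hv | ⟨j, hj, hv⟩ <;> rcases hw with hw | ⟨l, hl, hw⟩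
  · omega
  · omega
  · omega
  · obtain rfl : j = l := Fin.ext (by omega)
    omega

theorem apply_eq_of_blockTransversal_eq {K i : ℕ} {g g' : Fin K → Fin 3}
    (hi : 2 * (i * (K + 1)) + 2 * (K + 1) ≤ n)
    (h : blockTransversal n i g = blockTransversal n i g') (j : Fin K) (hj : (g j : ℕ) < 2) :
    g' j = g j := by
  have hmem : (⟨2 * (i * (K + 1)) + 2 * j + 2 + g j, by omega⟩ : Fin n) ∈
      blockTransversal n i g := mem_blockTransversal.2 (Or.inr ⟨j, hj, rfl⟩)
  rw [h, mem_blockTransversal] at hmem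
  rcases hmem with hm | ⟨l, hl, hm⟩
  · simp only at hm
    omega
  · simp only at hm
    obtain rfl : j = l := Fin.ext (by omega)
    exact Fin.ext (by omega)

theorem mul_three_pow_le_cliqueCount (K n : ℕ) :
    n / (2 * (K + 1)) * 3 ^ K ≤ (cocktailPartyUnion (K + 1) n).cliqueCount := by
  have hroom : ∀ i : Fin (n / (2 * (K + 1))),
      2 * ((i : ℕ) * (K + 1)) + 2 * (K + 1) ≤ n := fun i => by
    calc _ = ((i : ℕ) + 1) * (2 * (K + 1)) := by ring
      _ ≤ n / (2 * (K + 1)) * (2 * (K + 1)) := Nat.mul_le_mul_right _ i.2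
      _ ≤ n := Nat.div_mul_le_self _ _
  have hinj : Function.Injective
      (fun x : Fin (n / (2 * (K + 1))) × (Fin K → Fin 3) =>
        (⟨blockTransversal n x.1 x.2, isClique_blockTransversal x.2⟩ :
          {s : Finset (Fin n) // (cocktailPartyUnion (K + 1) n).IsClique (s : Set (Fin n))})) := by
    have hle : ∀ (i i' : Fin (n / (2 * (K + 1)))) (g g' : Fin K → Fin 3),
        blockTransversal n i g = blockTransversal n i' g' → (i' : ℕ) ≤ i := by
      intro i i' g g' h
      have hmem : (⟨2 * ((i : ℕ) * (K + 1)), by have := hroom i; omega⟩ : Fin n) ∈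
          blockTransversal n i g := mem_blockTransversal.2 (Or.inl rfl)
      rw [h, mem_blockTransversal] at hmem
      refine Nat.le_of_mul_le_mul_right (?_ : (i' : ℕ) * (K + 1) ≤ i * (K + 1)) K.succ_pos
      rcases hmem with hm | ⟨_, _, hm⟩ <;> simp only at hm <;> omega
    rintro ⟨i, g⟩ ⟨i', g'⟩ h
    have h : blockTransversal n i g = blockTransversal n i' g' := congrArg Subtype.val h
    obtain rfl : i = i' := Fin.ext ((hle _ _ _ _ h.symm).antisymm (hle _ _ _ _ h))
    congr 1
    funext j
    by_cases hj : (g j : ℕ) < 2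
    · exact (apply_eq_of_blockTransversal_eq (hroom i) h j hj).symm
    by_cases hj' : (g' j : ℕ) < 2
    · exact apply_eq_of_blockTransversal_eq (hroom i) h.symm j hj'
    exact Fin.ext (by omega)
  have := Nat.card_le_card_of_injective _ hinj
  simpa [cliqueCount] using this

end SimpleGraph

/-- An exponential `3 ^ (ε * t)` dominates the linear function `36 * t`. -/
theorem mul_le_three_rpow {ε t : ℝ} (hε : 0 < ε) (ht : 72 / ε ^ 2 ≤ t) :
    36 * t ≤ 3 ^ (ε * t) := by
  have ht0 : 0 ≤ t := le_trans (by positivity) ht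
  have hquad := Real.quadratic_le_exp_of_nonneg (mul_nonneg hε.le ht0)
  have hexp : Real.exp (ε * t) ≤ 3 ^ (ε * t) := by
    rw [← Real.exp_one_rpow]
    exact Real.rpow_le_rpow (Real.exp_pos 1).le Real.exp_one_lt_three.le (mul_nonneg hε.le ht0)
  have h72 : 72 ≤ t * ε ^ 2 := (div_le_iff₀ (by positivity)).1 ht
  nlinarith [mul_le_mul_of_nonneg_left h72 ht0, mul_nonneg hε.le ht0]

/-- For every `ε > 0` and sufficiently large `t`, for every `n ≥ 4t/3` there is a graph
on `n` vertices with no `K_t`-minor having at least `3 ^ ((2/3 - ε) t) * n` cliques. -/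
theorem exists_graph_no_complete_minor_many_cliques (ε : ℝ) (hε : 0 < ε) :
    ∃ t₀ : ℕ, ∀ t : ℕ, t₀ ≤ t → ∀ n : ℕ, 4 * t ≤ 3 * n →
      ∃ G : SimpleGraph (Fin n), ¬ (SimpleGraph.completeGraph (Fin t)).IsMinor G ∧
        3 ^ ((2 / 3 - ε) * t) * n ≤ (G.cliqueCount : ℝ) := by
  refine ⟨max 4 ⌈72 / ε ^ 2⌉₊, fun t ht n hn => ?_⟩
  have ht4 : 4 ≤ t := (le_max_left _ _).trans ht
  have htε : 72 / ε ^ 2 ≤ (t : ℝ) := Nat.ceil_le.1 ((le_max_right _ _).trans ht)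
  obtain ⟨K, hK, hK'⟩ : ∃ K : ℕ, 3 * (K + 1) < 2 * t ∧ 2 * t ≤ 3 * (K + 2) :=
    ⟨(2 * t - 4) / 3, by omega, by omega⟩
  refine ⟨SimpleGraph.cocktailPartyUnion (K + 1) n,
    SimpleGraph.not_completeGraph_isMinor_cocktailPartyUnion K.succ_pos hK, ?_⟩
  have hcount : ((n / (2 * (K + 1)) : ℕ) : ℝ) * 3 ^ K ≤
      (SimpleGraph.cocktailPartyUnion (K + 1) n).cliqueCount := by
    exact_mod_cast SimpleGraph.mul_three_pow_le_cliqueCount K n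
  refine le_trans ?_ hcount
  set q := n / (2 * (K + 1)) with hq
  have hq1 : 1 ≤ q := (Nat.one_le_div_iff (by omega)).2 (by omega)
  have hnq : n ≤ q * (4 * t) := by
    have h1 : n < 2 * (K + 1) * (q + 1) := Nat.lt_mul_div_succ n (by omega)
    nlinarith
  have hpow : (3 : ℝ) ^ ((2 / 3 - ε) * t) * (36 * t) ≤ 3 ^ K * 9 := by
    calc (3 : ℝ) ^ ((2 / 3 - ε) * t) * (36 * t)
        ≤ 3 ^ ((2 / 3 - ε) * t) * 3 ^ (ε * t) := by
          gcongr
          exact mul_le_three_rpow hε htε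
      _ = 3 ^ (2 / 3 * t : ℝ) := by
          rw [← Real.rpow_add (by norm_num)]
          congr 1
          ring
      _ ≤ 3 ^ ((K + 2 : ℕ) : ℝ) := by
          refine Real.rpow_le_rpow_of_exponent_le (by norm_num) ?_
          have : (2 * t : ℝ) ≤ 3 * ((K + 2 : ℕ) : ℝ) := by exact_mod_cast hK'
          linarith
      _ = 3 ^ K * 9 := by
          rw [Real.rpow_natCast, pow_add]
          norm_num
  calc (3 : ℝ) ^ ((2 / 3 - ε) * t) * n
      ≤ 3 ^ ((2 / 3 - ε) * t) * (q * (4 * t)) := by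
        gcongr
        exact_mod_cast hnq
    _ = q * (3 ^ ((2 / 3 - ε) * t) * (36 * t)) / 9 := by ring
    _ ≤ q * (3 ^ K * 9) / 9 := by gcongr
    _ = q * 3 ^ K := by ring
end

section
/- For every positive integer m, the graph on 2m vertices that is the complement of a perfect matching has exactly 3^m cliques and has clique number m; in particular, with s = 3m it attains equality in the bound that any graph with n(G) + ω(G) ≤ s has at most 3^{s/3} cliques. -/
/-- The complement of a perfect matching on `2m` vertices: vertices are `Fin m × Bool`
and two vertices are adjacent iff they lie in different matched pairs. -/
def matchingComplement (m : ℕ) : SimpleGraph (Fin m × Bool) where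
  Adj u v := u.1 ≠ v.1
  symm := ⟨fun _ _ h => Ne.symm h⟩
  loopless := ⟨fun _ h => h rfl⟩

/-- The graph on `2a + b` vertices that is the complement of a perfect matching on `2a`
vertices joined completely to a clique on `b` vertices; its complement is a matching of
size `a`. -/
def matchingJoinClique (a b : ℕ) : SimpleGraph ((Fin a × Bool) ⊕ Fin b) where
  Adj u v :=
    match u, v with
    | .inl x, .inl y => x.1 ≠ y.1
    | .inl _, .inr _ => True
    | .inr _, .inl _ => True
    | .inr i, .inr j => i ≠ j
  symm := by
    constructor
    intro u v h
    cases u <;> cases v <;> simp_all <;> exact Ne.symm h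
  loopless := by
    constructor
    intro u h
    cases u <;> simp_all

theorem matchingComplement_isClique_iff {m : ℕ} {s : Set (Fin m × Bool)} :
    (matchingComplement m).IsClique s ↔ Set.InjOn Prod.fst s := by
  refine ⟨fun h u hu v hv huv => ?_, fun h u hu v hv hne huv => hne (h hu hv huv)⟩
  by_contra hne
  exact h hu hv hne huv

/-- The clique determined by choosing, in each matched pair, one of its vertices or neither. -/
def matchingComplementCliqueOfChoice {m : ℕ} (f : Fin m → Option Bool) :
    {s : Finset (Fin m × Bool) // (matchingComplement m).IsClique (s : Set (Fin m × Bool))} :=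
  ⟨Finset.univ.filter fun p => f p.1 = some p.2,
    matchingComplement_isClique_iff.2 fun u hu v hv huv => by
      simp only [Finset.mem_coe, Finset.mem_filter, Finset.mem_univ, true_and] at hu hv
      exact Prod.ext huv (Option.some_injective _ (by rw [← hu, ← hv, huv]))⟩

theorem mem_matchingComplementCliqueOfChoice {m : ℕ} {f : Fin m → Option Bool}
    {p : Fin m × Bool} :
    p ∈ (matchingComplementCliqueOfChoice f).1 ↔ f p.1 = some p.2 := by
  simp [matchingComplementCliqueOfChoice]

theorem matchingComplementCliqueOfChoice_bijective (m : ℕ) :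
    Function.Bijective (matchingComplementCliqueOfChoice (m := m)) := by
  constructor
  · intro f g h
    funext i
    refine Option.ext fun b => ?_
    rw [← mem_matchingComplementCliqueOfChoice (p := (i, b)), h,
      mem_matchingComplementCliqueOfChoice]
  · rintro ⟨s, hs⟩
    rw [matchingComplement_isClique_iff] at hs
    refine ⟨fun i => if (i, true) ∈ s then some true else
      if (i, false) ∈ s then some false else none, Subtype.ext (Finset.ext ?_)⟩
    rintro ⟨i, b⟩
    have hnot : ¬ ((i, true) ∈ s ∧ (i, false) ∈ s) := fun ⟨ht, hf⟩ => by
      simpa using hs (Finset.mem_coe.2 ht) (Finset.mem_coe.2 hf) rfl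
    rw [mem_matchingComplementCliqueOfChoice]
    cases b <;> grind

theorem matchingComplement_cliqueCount (m : ℕ) : (matchingComplement m).cliqueCount = 3 ^ m := by
  rw [SimpleGraph.cliqueCount,
    ← Nat.card_eq_of_bijective _ (matchingComplementCliqueOfChoice_bijective m)]
  simp

theorem matchingComplement_cliqueNum (m : ℕ) : (matchingComplement m).cliqueNum = m := by
  apply le_antisymm
  · obtain ⟨s, hs⟩ := (matchingComplement m).exists_isNClique_cliqueNum
    rw [← hs.card_eq]
    simpa using Finset.card_le_card_of_injOn (t := Finset.univ) Prod.fst (by simp)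
      (matchingComplement_isClique_iff.1 hs.isClique)
  · have hclique : (matchingComplement m).IsClique
        (Finset.univ.image fun i : Fin m => (i, true) : Finset (Fin m × Bool)) :=
      matchingComplement_isClique_iff.2 fun u hu v hv huv => by
        simp only [Finset.coe_image, Finset.coe_univ, Set.image_univ, Set.mem_range] at hu hv
        obtain ⟨i, rfl⟩ := hu
        obtain ⟨j, rfl⟩ := hv
        exact congrArg (·, true) huv
    have hcard := hclique.card_le_cliqueNum
    rwa [Finset.card_image_of_injective _ (Prod.mk_left_injective true), Finset.card_univ,
      Fintype.card_fin] at hcard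

/-- The complement of a perfect matching on `2m` vertices has exactly `3^m` cliques and
clique number `m`; in particular, with `s = 3m` it attains equality in the bound
`3 ^ (s/3)` on the number of cliques of a graph with `n(G) + ω(G) ≤ s`. -/
theorem matchingComplement_cliqueCount_cliqueNum (m : ℕ) (hm : 0 < m) :
    (matchingComplement m).cliqueCount = 3 ^ m ∧
    (matchingComplement m).cliqueNum = m ∧
    Fintype.card (Fin m × Bool) + (matchingComplement m).cliqueNum = 3 * m ∧
    ((matchingComplement m).cliqueCount : ℝ) = 3 ^ ((3 * m : ℝ) / 3) := by
  refine ⟨matchingComplement_cliqueCount m, matchingComplement_cliqueNum m, ?_, ?_⟩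
  · rw [matchingComplement_cliqueNum, Fintype.card_prod, Fintype.card_fin, Fintype.card_bool]
    ring
  · rw [matchingComplement_cliqueCount, mul_div_cancel_left₀ _ three_ne_zero, Real.rpow_natCast]
    norm_cast
end

section
/- For every integer m ≥ 4, the graph on 2m vertices that is the complement of a perfect matching has Hadwiger number exactly ⌊3m/2⌋. -/
/-- A `K_t` minor of the complement of a perfect matching on `2m` vertices has `2t ≤ 3m`:
at most `m` branch sets are singletons, and all others use at least two vertices. -/
theorem two_mul_le_of_isMinor_matchingComplement {m t : ℕ}
    (h : (SimpleGraph.completeGraph (Fin t)).IsMinor (matchingComplement m)) : 2 * t ≤ 3 * m := by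
  obtain ⟨f, hne, -, hdisj, hadj⟩ := h
  have key : ∀ w, ∃ a ∈ f w, ∃ b ∈ f w, a = b → f w = {a} := by
    intro w
    obtain ⟨a, ha⟩ := hne w
    by_cases hs : f w = {a}
    · exact ⟨a, ha, a, ha, fun _ => hs⟩
    · obtain ⟨b, hb, hba⟩ : ∃ b ∈ f w, b ≠ a := by
        by_contra! hcon
        exact hs (Set.eq_singleton_iff_unique_mem.2 ⟨ha, hcon⟩)
      exact ⟨a, ha, b, hb, fun hab => absurd hab.symm hba⟩
  choose a ha b hb hab using key
  have eq_of_mem : ∀ {w₁ w₂ v}, v ∈ f w₁ → v ∈ f w₂ → w₁ = w₂ := by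
    intro w₁ w₂ v h₁ h₂
    by_contra hw
    exact Set.disjoint_left.1 (hdisj hw) h₁ h₂
  have eq_of_fst : ∀ {w₁ w₂}, a w₁ = b w₁ → a w₂ = b w₂ → (a w₁).1 = (a w₂).1 → w₁ = w₂ := by
    intro w₁ w₂ h₁ h₂ h₁₂
    by_contra hw
    obtain ⟨v₁, hv₁, v₂, hv₂, hv⟩ := hadj (w₁ := w₁) (w₂ := w₂) hw
    rw [hab _ h₁, Set.mem_singleton_iff] at hv₁
    rw [hab _ h₂, Set.mem_singleton_iff] at hv₂
    subst hv₁ hv₂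
    exact hv h₁₂
  let g : Fin t × Bool → (Fin m × Bool) ⊕ Fin m := fun p =>
    if p.2 then .inl (a p.1) else if a p.1 = b p.1 then .inr (a p.1).1 else .inl (b p.1)
  have hg : Function.Injective g := by
    rintro ⟨w₁, _ | _⟩ ⟨w₂, _ | _⟩ h <;> simp only [g] at h <;> grind
  have hcard := Fintype.card_le_of_injective g hg
  simp only [Fintype.card_prod, Fintype.card_sum, Fintype.card_fin, Fintype.card_bool] at hcard
  omega

/-- The vertices `(i, true)` together with the pairs `{(2j, false), (2j + 1, false)}` are the
branch sets of a complete minor. -/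
theorem completeGraph_isMinor_matchingComplement (m : ℕ) :
    (SimpleGraph.completeGraph (Fin (3 * m / 2))).IsMinor (matchingComplement m) := by
  let g : Fin m × Bool → ℕ := fun v => if v.2 then v.1 else m + v.1 / 2
  have hadj : ∀ u v, g u = g v → u ≠ v → (matchingComplement m).Adj u v := by
    rintro ⟨i, _ | _⟩ ⟨j, _ | _⟩ h hne hij <;>
      simp_all [g] <;> omega
  have hne : ∀ w : Fin (3 * m / 2), ∃ v, g v = w := by
    intro w
    by_cases hw : (w : ℕ) < m
    · exact ⟨(⟨w, hw⟩, true), by simp [g]⟩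
    · refine ⟨(⟨2 * (w - m), by omega⟩, false), ?_⟩
      simp only [g, Bool.false_eq_true, if_false]
      omega
  refine ⟨fun w => {v | g v = w}, hne, fun w => ?_, fun w₁ w₂ hw => ?_, fun w₁ w₂ hw => ?_⟩
  · obtain ⟨v₀, hv₀⟩ := hne w
    refine (SimpleGraph.connected_iff _).2 ⟨fun u v => ?_, ⟨⟨v₀, hv₀⟩⟩⟩
    by_cases huv : u = v
    · exact huv ▸ .refl _
    · exact SimpleGraph.Adj.reachable
        (hadj u v (u.2.trans v.2.symm) fun h => huv (Subtype.ext h))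
  · exact Set.disjoint_left.2 fun v h₁ h₂ => hw (Fin.ext (h₁.symm.trans h₂))
  · have hpair : ∀ w : Fin (3 * m / 2), m ≤ (w : ℕ) → ∀ e < 2, ∃ v, g v = w ∧
        (v.1 : ℕ) = 2 * (w - m) + e := by
      intro w hw e he
      refine ⟨(⟨2 * (w - m) + e, by omega⟩, false), ?_, rfl⟩
      simp only [g, Bool.false_eq_true, if_false]
      omega
    have hsing : ∀ w : Fin (3 * m / 2), (w : ℕ) < m → ∃ v, g v = w ∧ (v.1 : ℕ) = w :=
      fun w hw => ⟨(⟨w, hw⟩, true), by simp [g], rfl⟩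
    have hw' : (w₁ : ℕ) ≠ w₂ := fun h => hw (Fin.ext h)
    suffices ∃ v₁, g v₁ = w₁ ∧ ∃ v₂, g v₂ = w₂ ∧ (v₁.1 : ℕ) ≠ v₂.1 by
      obtain ⟨v₁, h₁, v₂, h₂, h⟩ := this
      exact ⟨v₁, h₁, v₂, h₂, fun h' => h (congrArg Fin.val h')⟩
    rcases lt_or_ge (w₁ : ℕ) m with h₁ | h₁ <;> rcases lt_or_ge (w₂ : ℕ) m with h₂ | h₂
    · obtain ⟨v₁, hg₁, hv₁⟩ := hsing w₁ h₁
      obtain ⟨v₂, hg₂, hv₂⟩ := hsing w₂ h₂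
      exact ⟨v₁, hg₁, v₂, hg₂, by omega⟩
    · obtain ⟨v₁, hg₁, hv₁⟩ := hsing w₁ h₁
      obtain ⟨v₂, hg₂, hv₂⟩ := hpair w₂ h₂ ((w₁ + 1) % 2) (by omega)
      exact ⟨v₁, hg₁, v₂, hg₂, by omega⟩
    · obtain ⟨v₁, hg₁, hv₁⟩ := hpair w₁ h₁ ((w₂ + 1) % 2) (by omega)
      obtain ⟨v₂, hg₂, hv₂⟩ := hsing w₂ h₂
      exact ⟨v₁, hg₁, v₂, hg₂, by omega⟩
    · obtain ⟨v₁, hg₁, hv₁⟩ := hpair w₁ h₁ 0 (by omega)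
      obtain ⟨v₂, hg₂, hv₂⟩ := hpair w₂ h₂ 0 (by omega)
      exact ⟨v₁, hg₁, v₂, hg₂, by omega⟩

/-- For `m ≥ 4`, the complement of a perfect matching on `2m` vertices has
Hadwiger number exactly `⌊3m/2⌋`. -/
theorem matchingComplement_hadwigerNumber (m : ℕ) (hm : 4 ≤ m) :
    (matchingComplement m).hadwigerNumber = 3 * m / 2 := by
  refine IsGreatest.csSup_eq ⟨completeGraph_isMinor_matchingComplement m, fun t ht => ?_⟩
  have := two_mul_le_of_isMinor_matchingComplement ht
  omega
end

section
/- Every social graph G whose complement has maximum degree Δ has at most 300Δ² bad vertices. -/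
/-- The graph obtained from `G` by contracting the edge `uv`: the vertex `v` is removed
and its neighbors are attached to `u`. -/
def SimpleGraph.contractEdge {V : Type*} (G : SimpleGraph V) (u v : V) :
    SimpleGraph {x : V // x ≠ v} where
  Adj x y := x.1 ≠ y.1 ∧
    (G.Adj x.1 y.1 ∨ (x.1 = u ∧ G.Adj v y.1) ∨ (y.1 = u ∧ G.Adj v x.1))
  symm := by
    constructor
    rintro x y ⟨hne, h⟩
    refine ⟨hne.symm, ?_⟩
    rcases h with h | ⟨h1, h2⟩ | ⟨h1, h2⟩
    · exact Or.inl h.symm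
    · exact Or.inr (Or.inr ⟨h1, h2⟩)
    · exact Or.inr (Or.inl ⟨h1, h2⟩)
  loopless := by
    constructor
    rintro x ⟨hne, -⟩
    exact hne rfl

/-- `G` is a social graph: contracting an edge never increases the number of cliques. -/
def SimpleGraph.IsSocial {V : Type*} [Fintype V] [DecidableEq V] (G : SimpleGraph V) : Prop :=
  ∀ u v : V, G.Adj u v → (G.contractEdge u v).cliqueCount ≤ G.cliqueCount

/-- `α* = (2 - √2)/2 - 0.001`. -/
noncomputable def alphaStar : ℝ := (2 - Real.sqrt 2) / 2 - 0.001

open Finset in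
/-- A vertex adjacent to all other vertices lies in at least half of the cliques. -/
theorem SimpleGraph.cliqueCount_le_two_mul_cliqueCountOn {V : Type*} [Fintype V]
    [DecidableEq V] (G : SimpleGraph V) (v : V) (hv : ∀ w, w ≠ v → G.Adj v w) :
    G.cliqueCount ≤ 2 * G.cliqueCountOn v := by
  classical
  have hinj : Function.Injective
      (fun s : {s : Finset V // G.IsClique (s : Set V)} =>
        ((decide (v ∈ s.1), ⟨insert v s.1, by
          rw [coe_insert]
          exact s.2.insert fun w _ hw => hv w hw.symm, mem_insert_self _ _⟩) :
          Bool × {s : Finset V // G.IsClique (s : Set V) ∧ v ∈ s})) := by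
    rintro ⟨s, hs⟩ ⟨t, ht⟩ h
    simp only [Prod.mk.injEq, decide_eq_decide, Subtype.mk.injEq] at h
    obtain ⟨h₁, h₂⟩ := h
    ext w
    have := congrArg (w ∈ ·) h₂
    by_cases hw : w = v
    · subst hw; exact h₁
    · simpa [hw] using this
  simpa [SimpleGraph.cliqueCount, SimpleGraph.cliqueCountOn] using
    Nat.card_le_card_of_injective _ hinj

open Classical Finset in
/-- If every vertex outside `u, v` is adjacent to `u` or to `v`, then each clique avoiding both
yields two cliques of the graph in which `uv` is contracted. -/
theorem SimpleGraph.two_mul_card_le_cliqueCount_contractEdge {V : Type*} [Fintype V]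
    (G : SimpleGraph V) (u v : V) (huv : u ≠ v)
    (h : ∀ w, w ≠ u → w ≠ v → G.Adj u w ∨ G.Adj v w) (T : Finset (Finset V))
    (hT : ∀ s ∈ T, G.IsClique (s : Set V) ∧ u ∉ s ∧ v ∉ s) :
    2 * #T ≤ (G.contractEdge u v).cliqueCount := by
  let u' : {x : V // x ≠ v} := ⟨u, huv⟩
  have hclique : ∀ s : Finset V, G.IsClique (s : Set V) →
      (G.contractEdge u v).IsClique ((s.subtype (· ≠ v) : Finset {x : V // x ≠ v}) : Set _) := by
    intro s hs x hx y hy hxy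
    rw [mem_coe, mem_subtype] at hx hy
    have hne : x.1 ≠ y.1 := fun e => hxy (Subtype.ext e)
    exact ⟨hne, Or.inl (hs hx hy hne)⟩
  have hadj : ∀ w : {x : V // x ≠ v}, u' ≠ w → (G.contractEdge u v).Adj u' w := by
    intro w hw
    have hne : u ≠ w.1 := fun e => hw (Subtype.ext e)
    refine ⟨hne, ?_⟩
    rcases h w.1 hne.symm w.2 with h | h
    · exact Or.inl h
    · exact Or.inr (Or.inl ⟨rfl, h⟩)
  let S := {s : Finset V // s ∈ T}
  let f : Bool × S → {s : Finset {x : V // x ≠ v} // (G.contractEdge u v).IsClique (s : Set _)} :=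
    fun p => ⟨if p.1 then insert u' (p.2.1.subtype _) else p.2.1.subtype _, by
      split_ifs
      · rw [coe_insert]
        exact (hclique _ (hT _ p.2.2).1).insert fun w _ hw => hadj w hw
      · exact hclique _ (hT _ p.2.2).1⟩
  have hmem : ∀ p : Bool × S, u' ∈ (f p).1 ↔ p.1 = true := by
    rintro ⟨b, s, hs⟩
    cases b <;> simp [f, u', (hT s hs).2.1]
  have hmem' : ∀ (p : Bool × S) (w : {x : V // x ≠ v}), w ≠ u' →
      (w ∈ (f p).1 ↔ w.1 ∈ p.2.1) := by
    rintro ⟨b, s, hs⟩ w hw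
    cases b <;> simp [f, hw]
  have hinj : Function.Injective f := by
    intro p q hpq
    have h₁ : p.1 = q.1 := by
      have := (hmem p).symm.trans ((hpq ▸ Iff.rfl : u' ∈ (f p).1 ↔ u' ∈ (f q).1).trans (hmem q))
      exact Bool.eq_iff_iff.2 this
    refine Prod.ext h₁ (Subtype.ext ?_)
    ext w
    by_cases hwv : w = v
    · subst hwv; exact iff_of_false (hT _ p.2.2).2.2 (hT _ q.2.2).2.2
    by_cases hwu : w = u
    · subst hwu; exact iff_of_false (hT _ p.2.2).2.1 (hT _ q.2.2).2.1
    have hw : (⟨w, hwv⟩ : {x : V // x ≠ v}) ≠ u' := fun e => hwu (congrArg Subtype.val e)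
    rw [← hmem' p ⟨w, hwv⟩ hw, ← hmem' q ⟨w, hwv⟩ hw, hpq]
  have := Nat.card_le_card_of_injective f hinj
  rw [Nat.card_prod, Nat.card_eq_fintype_card, Fintype.card_bool, Nat.card_eq_fintype_card,
    Fintype.card_coe] at this
  exact this

open Finset in
/-- At most `Δ² + 1` vertices lie within distance two of a given vertex, where `Δ` is the
maximum degree. -/
theorem SimpleGraph.card_eq_or_adj_or_common_neighbor_le {V : Type*} [Fintype V] [DecidableEq V]
    (H : SimpleGraph V) [DecidableRel H.Adj] (u : V) (s : Finset V)
    (hs : ∀ v ∈ s, v = u ∨ H.Adj u v ∨ ∃ w, H.Adj u w ∧ H.Adj w v) :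
    #s ≤ H.maxDegree ^ 2 + 1 := by
  have hsub : s ⊆ insert u
      ((H.neighborFinset u).biUnion fun w => (insert w (H.neighborFinset w)).erase u) := by
    intro v hv
    by_cases hvu : v = u
    · simp [hvu]
    simp only [mem_insert, mem_biUnion, mem_erase, mem_neighborFinset]
    rcases hs v hv with h | h | ⟨w, h₁, h₂⟩
    · exact Or.inl h
    · exact Or.inr ⟨v, h, hvu, Or.inl rfl⟩
    · exact Or.inr ⟨w, h₁, hvu, Or.inr h₂⟩
  refine (card_le_card hsub).trans ((card_insert_le _ _).trans (Nat.succ_le_succ ?_))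
  refine (card_biUnion_le_card_mul _ _ H.maxDegree fun w hw => ?_).trans ?_
  · have hu : u ∈ insert w (H.neighborFinset w) := by
      rw [mem_neighborFinset] at hw
      simp [hw.symm]
    rw [card_erase_of_mem hu]
    have := card_insert_le w (H.neighborFinset w)
    have := H.degree_le_maxDegree w
    rw [← card_neighborFinset_eq_degree] at this
    omega
  · rw [card_neighborFinset_eq_degree, sq]
    exact Nat.mul_le_mul_right _ (H.degree_le_maxDegree u)

open Finset in
/-- Double counting: the square of the total number of non-memberships is controlled by the pair
counts. -/
theorem Finset.sq_sum_card_filter_notMem_le {V : Type*} [DecidableEq V]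
    (F : Finset (Finset V)) (B : Finset V) :
    (∑ u ∈ B, (#{s ∈ F | u ∉ s} : ℝ)) ^ 2 ≤
      #F * ∑ u ∈ B, ∑ v ∈ B, (#{s ∈ F | u ∉ s ∧ v ∉ s} : ℝ) := by
  have h₁ : ∑ u ∈ B, (#{s ∈ F | u ∉ s} : ℝ) =
      ∑ s ∈ F, ∑ u ∈ B, if u ∉ s then (1 : ℝ) else 0 := by
    rw [sum_comm]
    exact sum_congr rfl fun u _ => (sum_boole _ _).symm
  have h₂ : ∑ u ∈ B, ∑ v ∈ B, (#{s ∈ F | u ∉ s ∧ v ∉ s} : ℝ) =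
      ∑ s ∈ F, (∑ u ∈ B, if u ∉ s then (1 : ℝ) else 0) ^ 2 := by
    simp_rw [sq, sum_mul_sum, ← sum_boole (R := ℝ)]
    rw [sum_comm (s := F)]
    refine sum_congr rfl fun u _ => ?_
    rw [sum_comm (s := F)]
    refine sum_congr rfl fun v _ => sum_congr rfl fun s _ => ?_
    split_ifs <;> simp_all
  rw [h₁, h₂]
  exact sq_sum_le_card_mul_sum_sq

/-- The quadratic inequality behind the bound on the number of bad vertices: `m` is their number,
`C` the number of cliques and `A` the total number of non-memberships. -/
theorem bad_vertex_count_bound {A C c m : ℝ} (hC : 0 < C) (hm : 0 < m) (hc : 0 ≤ c)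
    (hA : (1 - alphaStar) * (m * C) ≤ A)
    (h : A ^ 2 ≤ C * (m * (m * C / 2) + c * (A - m * C / 2))) :
    m ≤ 150 * c := by
  obtain ⟨b, rfl⟩ : ∃ b, A = b * (m * C) := ⟨A / (m * C), by field_simp⟩
  have hmC : 0 < m * C := mul_pos hm hC
  have hb : 1 - alphaStar ≤ b := le_of_mul_le_mul_right hA hmC
  have hb₁ : Real.sqrt 2 / 2 + 0.001 ≤ b := by
    unfold alphaStar at hb; linarith
  have h2 : Real.sqrt 2 ^ 2 = 2 := Real.sq_sqrt (by norm_num)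
  have hr : 1.4142 ≤ Real.sqrt 2 := Real.le_sqrt_of_sq_le (by norm_num)
  have hr' : Real.sqrt 2 ≤ 1.4143 := Real.sqrt_le_iff.2 (by norm_num)
  have hkey : m * (b ^ 2 - 1 / 2) ≤ c * (b - 1 / 2) := by
    refine le_of_mul_le_mul_right ?_ (mul_pos hmC hC)
    nlinarith [h]
  have hbb : b - 1 / 2 ≤ 150 * (b ^ 2 - 1 / 2) := by
    nlinarith [mul_self_nonneg (b - (Real.sqrt 2 / 2 + 0.001))]
  have hpos : 0 < b ^ 2 - 1 / 2 := by nlinarith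
  refine le_of_mul_le_mul_right ?_ hpos
  nlinarith [mul_le_mul_of_nonneg_left hbb hc]

/-- A social graph whose complement has maximum degree `Δ` has at most `300 Δ²` bad
vertices, where a vertex is bad if it lies in a fraction less than `α*` of the cliques. -/
theorem social_graph_few_bad_vertices {V : Type*} [Fintype V] [DecidableEq V]
    (G : SimpleGraph V) [DecidableRel G.Adj] (hG : G.IsSocial) :
    Nat.card {v : V // (G.cliqueCountOn v : ℝ) / G.cliqueCount < alphaStar} ≤
      300 * Gᶜ.maxDegree ^ 2 := by
  classical
  let F : Finset (Finset V) := {s | G.IsClique (s : Set V)}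
  have hCF : G.cliqueCount = F.card := by
    rw [SimpleGraph.cliqueCount, Nat.card_eq_fintype_card, Fintype.card_subtype]
  have hF : 0 < F.card := Finset.card_pos.2 ⟨∅, by simp [F]⟩
  have hC : (0 : ℝ) < G.cliqueCount := by rw [hCF]; exact_mod_cast hF
  have hr : 1.4142 ≤ Real.sqrt 2 := Real.le_sqrt_of_sq_le (by norm_num)
  have hα : alphaStar < 1 / 2 := by unfold alphaStar; linarith
  let B : Finset V := {v | (G.cliqueCountOn v : ℝ) / G.cliqueCount < alphaStar}
  have hB : Nat.card {v : V // (G.cliqueCountOn v : ℝ) / G.cliqueCount < alphaStar} = B.card := by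
    rw [Nat.card_eq_fintype_card, Fintype.card_subtype]
  rw [hB]
  have hbad : ∀ u ∈ B, (G.cliqueCountOn u : ℝ) < alphaStar * G.cliqueCount := fun u hu =>
    (div_lt_iff₀ hC).1 (Finset.mem_filter.1 hu).2
  rcases B.eq_empty_or_nonempty with hBe | hBne
  · simp [hBe]
  have hΔ : 1 ≤ Gᶜ.maxDegree := by
    by_contra hΔ
    obtain ⟨v, hv⟩ := hBne
    have huniv : ∀ w, w ≠ v → G.Adj v w := by
      intro w hw
      by_contra hvw
      have hadj : Gᶜ.Adj v w := ⟨hw.symm, hvw⟩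
      have := (Gᶜ.degree_pos_iff_exists_adj v).2 ⟨w, hadj⟩
      have := Gᶜ.degree_le_maxDegree v
      omega
    have h₁ : (G.cliqueCount : ℝ) ≤ 2 * G.cliqueCountOn v := by
      exact_mod_cast G.cliqueCount_le_two_mul_cliqueCountOn v huniv
    nlinarith [hbad v hv]
  let N : V → ℝ := fun u => (F.filter fun s => u ∉ s).card
  have hN : ∀ u, (G.cliqueCountOn u : ℝ) + N u = G.cliqueCount := by
    intro u
    have h₁ : G.cliqueCountOn u = (F.filter fun s => u ∈ s).card := by
      rw [SimpleGraph.cliqueCountOn, Nat.card_eq_fintype_card, Fintype.card_subtype,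
        Finset.filter_filter]
    rw [h₁, hCF]
    simp only [N]
    exact_mod_cast Finset.card_filter_add_card_filter_not (s := F) (fun s => u ∈ s)
  have hNlow : ∀ u ∈ B, (1 - alphaStar) * G.cliqueCount ≤ N u := fun u hu => by
    linarith [hbad u hu, hN u]
  have hpair : ∀ u v, v ≠ u → ¬ Gᶜ.Adj u v → (¬ ∃ w, Gᶜ.Adj u w ∧ Gᶜ.Adj w v) →
      ((F.filter fun s => u ∉ s ∧ v ∉ s).card : ℝ) ≤ G.cliqueCount / 2 := by
    intro u v hne hnadj hcommon
    have hadj : G.Adj u v := by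
      by_contra h
      exact hnadj ⟨hne.symm, h⟩
    have hcover : ∀ w, w ≠ u → w ≠ v → G.Adj u w ∨ G.Adj v w := by
      intro w hwu hwv
      by_contra! h
      exact hcommon ⟨w, ⟨hwu.symm, h.1⟩, ⟨hwv, fun h' => h.2 h'.symm⟩⟩
    have h₁ := (G.two_mul_card_le_cliqueCount_contractEdge u v hne.symm hcover
      (F.filter fun s => u ∉ s ∧ v ∉ s) (by simp [F])).trans (hG u v hadj)
    have h₂ : (2 : ℝ) * (F.filter fun s => u ∉ s ∧ v ∉ s).card ≤ G.cliqueCount := by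
      exact_mod_cast h₁
    linarith
  have hrow : ∀ u ∈ B, ∑ v ∈ B, ((F.filter fun s => u ∉ s ∧ v ∉ s).card : ℝ) ≤
      B.card * (G.cliqueCount / 2) +
        ((Gᶜ.maxDegree : ℝ) ^ 2 + 1) * (N u - G.cliqueCount / 2) := by
    intro u hu
    let near : V → Prop := fun v => v = u ∨ Gᶜ.Adj u v ∨ ∃ w, Gᶜ.Adj u w ∧ Gᶜ.Adj w v
    have hNu : 0 ≤ N u - G.cliqueCount / 2 := by
      have := hNlow u hu
      nlinarith
    have hterm : ∀ v ∈ B, ((F.filter fun s => u ∉ s ∧ v ∉ s).card : ℝ) ≤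
        G.cliqueCount / 2 + (if near v then 1 else 0) * (N u - G.cliqueCount / 2) := by
      intro v _
      by_cases hv : near v
      · have : ((F.filter fun s => u ∉ s ∧ v ∉ s).card : ℝ) ≤ N u := by
          simp only [N, Nat.cast_le]
          exact Finset.card_le_card (Finset.monotone_filter_right _ fun s _ h => h.1)
        simp only [hv, if_true]
        linarith
      · simp only [hv, if_false]
        simp only [near, not_or] at hv
        linarith [hpair u v hv.1 hv.2.1 hv.2.2]
    have hcard : ((B.filter near).card : ℝ) ≤ (Gᶜ.maxDegree : ℝ) ^ 2 + 1 := by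
      exact_mod_cast Gᶜ.card_eq_or_adj_or_common_neighbor_le u (B.filter near)
        fun v hv => (Finset.mem_filter.1 hv).2
    refine (Finset.sum_le_sum hterm).trans ?_
    rw [Finset.sum_add_distrib, ← Finset.sum_mul, Finset.sum_boole, Finset.sum_const,
      nsmul_eq_mul]
    gcongr
  have hA : (1 - alphaStar) * (B.card * G.cliqueCount) ≤ ∑ u ∈ B, N u := by
    have := Finset.sum_le_sum hNlow
    rw [Finset.sum_const, nsmul_eq_mul] at this
    linarith
  have hquad : (∑ u ∈ B, N u) ^ 2 ≤ G.cliqueCount * (B.card * (B.card * G.cliqueCount / 2) +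
      ((Gᶜ.maxDegree : ℝ) ^ 2 + 1) * (∑ u ∈ B, N u - B.card * G.cliqueCount / 2)) := by
    have h₁ := Finset.sq_sum_card_filter_notMem_le F B
    rw [← hCF] at h₁
    refine h₁.trans (mul_le_mul_of_nonneg_left ((Finset.sum_le_sum hrow).trans_eq ?_) hC.le)
    rw [Finset.sum_add_distrib, ← Finset.mul_sum, ← Finset.mul_sum, Finset.sum_sub_distrib]
    simp only [Finset.sum_const, nsmul_eq_mul]
    ring
  have hfinal := bad_vertex_count_bound hC (by exact_mod_cast hBne.card_pos) (by positivity)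
    hA hquad
  have hΔ' : (1 : ℝ) ≤ Gᶜ.maxDegree := by exact_mod_cast hΔ
  have : (B.card : ℝ) ≤ 300 * (Gᶜ.maxDegree : ℝ) ^ 2 := by nlinarith
  exact_mod_cast this
end

section
/- In every social graph G whose complement has maximum degree Δ, all but at most 600Δ³ vertices have degree at most one in the complement of G. -/
open Finset

namespace SimpleGraph

section CliqueFamily

open scoped Classical

variable {V : Type*} [Fintype V]

/-- The family of all cliques of `G`. -/
noncomputable def cliqueFamily (G : SimpleGraph V) : Finset (Finset V) :=
  univ.filter fun s => G.IsClique (s : Set V)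

theorem mem_cliqueFamily {G : SimpleGraph V} {s : Finset V} :
    s ∈ G.cliqueFamily ↔ G.IsClique (s : Set V) := by
  simp [cliqueFamily]

theorem card_cliqueFamily (G : SimpleGraph V) : #G.cliqueFamily = G.cliqueCount :=
  (Nat.subtype_card _ fun _ => mem_cliqueFamily).symm

theorem cliqueFamily_card_pos (G : SimpleGraph V) : 0 < #G.cliqueFamily :=
  card_pos.2 ⟨∅, mem_cliqueFamily.2 (by simp)⟩

theorem erase_mem_cliqueFamily {G : SimpleGraph V} {s : Finset V} (hs : s ∈ G.cliqueFamily)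
    (v : V) : s.erase v ∈ G.cliqueFamily :=
  mem_cliqueFamily.2 ((mem_cliqueFamily.1 hs).subset (by simp))

/-- A vertex is rare if at most two sevenths of the cliques contain it. -/
def IsRare (G : SimpleGraph V) (v : V) : Prop :=
  7 * #{s ∈ G.cliqueFamily | v ∈ s} ≤ 2 * #G.cliqueFamily

theorem notMem_of_mem_cliqueFamily {G : SimpleGraph V} {s : Finset V} (hs : s ∈ G.cliqueFamily)
    {v w : V} (hv : v ∈ s) (hvw : Gᶜ.Adj v w) : w ∉ s := fun hw =>
  ((compl_adj G v w).1 hvw).2 (mem_cliqueFamily.1 hs hv hw hvw.ne)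

/-- Among the three vertices of a two-edge path in the complement, one is rare. -/
theorem isRare_or_isRare_or_isRare {G : SimpleGraph V} {v a b : V} (ha : Gᶜ.Adj v a)
    (hb : Gᶜ.Adj v b) (hab : a ≠ b) : G.IsRare v ∨ G.IsRare a ∨ G.IsRare b := by
  set Q := G.cliqueFamily with hQ
  have hv : #{s ∈ Q | v ∈ s} ≤ #{s ∈ Q | v ∉ s ∧ a ∉ s ∧ b ∉ s} := by
    refine card_le_card_of_injOn (fun s => s.erase v) ?_ ?_
    · intro s hs
      obtain ⟨hs, hvs⟩ := mem_filter.1 hs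
      have h1 := notMem_of_mem_cliqueFamily hs hvs ha
      have h2 := notMem_of_mem_cliqueFamily hs hvs hb
      exact mem_filter.2 ⟨erase_mem_cliqueFamily hs v, by simp [h1, h2]⟩
    · intro s hs t ht h
      exact erase_injOn' v (mem_filter.1 hs).2 (mem_filter.1 ht).2 h
  have hb' : #{s ∈ Q | a ∈ s ∧ b ∈ s} ≤ #{s ∈ Q | a ∉ s ∧ b ∈ s} := by
    refine card_le_card_of_injOn (fun s => s.erase a) ?_ ?_
    · intro s hs
      obtain ⟨hs, has, hbs⟩ := mem_filter.1 hs
      exact mem_filter.2 ⟨erase_mem_cliqueFamily hs a, by simp [hbs, hab.symm]⟩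
    · intro s hs t ht h
      exact erase_injOn' a (mem_filter.1 hs).2.1 (mem_filter.1 ht).2.1 h
  have hsplit : #{s ∈ Q | b ∈ s} = #{s ∈ Q | a ∈ s ∧ b ∈ s} + #{s ∈ Q | a ∉ s ∧ b ∈ s} := by
    rw [← card_filter_add_card_filter_not (s := {s ∈ Q | b ∈ s}) (fun s => a ∈ s),
      filter_filter, filter_filter]
    simp only [and_comm]
  have hsum : #{s ∈ Q | v ∈ s} + #{s ∈ Q | v ∉ s ∧ a ∉ s ∧ b ∉ s} + #{s ∈ Q | a ∈ s} +
      #{s ∈ Q | a ∉ s ∧ b ∈ s} ≤ #Q := by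
    simp only [card_filter, ← sum_add_distrib]
    rw [card_eq_sum_ones]
    refine sum_le_sum fun s hs => ?_
    have h1 := fun h : v ∈ s => notMem_of_mem_cliqueFamily hs h ha
    have h2 := fun h : v ∈ s => notMem_of_mem_cliqueFamily hs h hb
    by_cases hv : v ∈ s <;> by_cases ha : a ∈ s <;> by_cases hb : b ∈ s <;> simp_all
  simp only [IsRare, ← hQ]
  omega

/-- If `u ≠ v` have no common non-neighbor, then contracting `uv` yields
at least twice as many cliques as there are cliques avoiding both. -/
theorem two_mul_card_avoiding_le_cliqueCount_contractEdge {G : SimpleGraph V} {u v : V}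
    (huv : u ≠ v) (h : ∀ w, ¬ (Gᶜ.Adj u w ∧ Gᶜ.Adj v w)) :
    2 * #{s ∈ G.cliqueFamily | u ∉ s ∧ v ∉ s} ≤ (G.contractEdge u v).cliqueCount := by
  rw [← card_cliqueFamily]
  set A := {s ∈ G.cliqueFamily | u ∉ s ∧ v ∉ s}
  let u' : {x : V // x ≠ v} := ⟨u, huv⟩
  let r : Finset V → Finset {x : V // x ≠ v} := fun s => s.subtype (· ≠ v)
  have hu' : ∀ s ∈ A, u' ∉ r s := fun s hs hu =>
    (mem_filter.1 hs).2.1 (mem_subtype.1 hu)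
  have hr : Set.InjOn r A := by
    intro s hs t ht hst
    have hs' := (mem_filter.1 hs).2.2
    have ht' := (mem_filter.1 ht).2.2
    ext x
    by_cases hx : x = v
    · subst hx; simp [hs', ht']
    · have := congrArg (fun f => (⟨x, hx⟩ : {x : V // x ≠ v}) ∈ f) hst
      simpa [r] using this
  have hclique : ∀ s ∈ A, (G.contractEdge u v).IsClique (r s : Set {x : V // x ≠ v}) := by
    intro s hs x hx y hy hxy
    have hne : x.1 ≠ y.1 := fun h => hxy (Subtype.ext h)
    exact ⟨hne, Or.inl (mem_cliqueFamily.1 (mem_filter.1 hs).1 (mem_subtype.1 hx)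
      (mem_subtype.1 hy) hne)⟩
  have huniv : ∀ y : {x : V // x ≠ v}, u' ≠ y → (G.contractEdge u v).Adj u' y := by
    intro y hy
    have hne : u ≠ y.1 := fun h => hy (Subtype.ext h)
    refine ⟨hne, ?_⟩
    have := h y.1
    simp only [compl_adj, not_and_or, not_not] at this
    rcases this with (h1 | h1) | (h1 | h1)
    · exact absurd h1 hne
    · exact Or.inl h1
    · exact absurd h1.symm y.2
    · exact Or.inr (Or.inl ⟨rfl, h1⟩)
  have hdisj : Disjoint (A.image r) (A.image fun s => insert u' (r s)) := by
    rw [Finset.disjoint_left]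
    intro t ht ht'
    obtain ⟨s, hs, rfl⟩ := mem_image.1 ht
    obtain ⟨s', -, he⟩ := mem_image.1 ht'
    exact hu' s hs (he ▸ mem_insert_self _ _)
  have hinj : Set.InjOn (fun s => insert u' (r s)) A := by
    intro s hs t ht hst
    refine hr hs ht ?_
    have := congrArg (fun f => f.erase u') hst
    simpa [hu' s hs, hu' t ht] using this
  calc 2 * #A = #(A.image r ∪ A.image fun s => insert u' (r s)) := by
        rw [card_union_of_disjoint hdisj, card_image_of_injOn hr, card_image_of_injOn hinj,
          two_mul]
    _ ≤ _ := by
        refine card_le_card fun t ht => mem_cliqueFamily.2 ?_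
        rcases mem_union.1 ht with ht | ht
        · obtain ⟨s, hs, rfl⟩ := mem_image.1 ht
          exact hclique s hs
        · obtain ⟨s, hs, rfl⟩ := mem_image.1 ht
          rw [coe_insert]
          exact (hclique s hs).insert fun y _ hy => huniv y hy

/-- A second-moment bound: if each vertex of `B` is rare, then on average at least `25/49` of the
cliques avoid both vertices of a pair from `B`. -/
theorem sum_card_avoiding_ge {G : SimpleGraph V} {B : Finset V} (hB : ∀ u ∈ B, G.IsRare u) :
    25 * #B ^ 2 * #G.cliqueFamily ≤
      49 * ∑ u ∈ B, ∑ v ∈ B, #{s ∈ G.cliqueFamily | u ∉ s ∧ v ∉ s} := by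
  set Q := G.cliqueFamily
  have hsum : ∑ u ∈ B, ∑ v ∈ B, #{s ∈ Q | u ∉ s ∧ v ∉ s} = ∑ s ∈ Q, #(B \ s) ^ 2 := by
    simp only [card_filter]
    simp_rw [sum_comm (t := Q)]
    refine sum_congr rfl fun s _ => ?_
    rw [← filter_notMem_eq_sdiff, card_filter, sq, sum_mul_sum]
    refine sum_congr rfl fun u _ => sum_congr rfl fun v _ => ?_
    by_cases hu : u ∈ s <;> by_cases hv : v ∈ s <;> simp [hu, hv]
  have hfirst : 5 * (#B * #Q) ≤ 7 * ∑ s ∈ Q, #(B \ s) := by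
    have hcomm : ∑ s ∈ Q, #(B \ s) = ∑ u ∈ B, #{s ∈ Q | u ∉ s} := by
      simp only [← filter_notMem_eq_sdiff, card_filter]
      exact sum_comm
    rw [hcomm, mul_sum, mul_left_comm, ← smul_eq_mul, ← sum_const]
    refine sum_le_sum fun u hu => ?_
    have h1 : 7 * #{s ∈ Q | u ∈ s} ≤ 2 * #Q := hB u hu
    have h2 := card_filter_add_card_filter_not (s := Q) (fun s => u ∈ s)
    omega
  have hcs : (∑ s ∈ Q, #(B \ s)) ^ 2 ≤ #Q * ∑ s ∈ Q, #(B \ s) ^ 2 :=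
    sq_sum_le_card_mul_sum_sq
  have hpos : 0 < #Q := G.cliqueFamily_card_pos
  rw [hsum]
  refine Nat.le_of_mul_le_mul_left ?_ hpos
  calc #Q * (25 * #B ^ 2 * #Q) = (5 * (#B * #Q)) ^ 2 := by ring
    _ ≤ (7 * ∑ s ∈ Q, #(B \ s)) ^ 2 := Nat.pow_le_pow_left hfirst 2
    _ = 49 * (∑ s ∈ Q, #(B \ s)) ^ 2 := by ring
    _ ≤ 49 * (#Q * ∑ s ∈ Q, #(B \ s) ^ 2) := Nat.mul_le_mul_left _ hcs
    _ = #Q * (49 * ∑ s ∈ Q, #(B \ s) ^ 2) := by ring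

end CliqueFamily

variable {V : Type*} [Fintype V] [DecidableEq V]

/-- The vertices at distance at most two from `u` in `H`. -/
def ballTwo (H : SimpleGraph V) [DecidableRel H.Adj] (u : V) : Finset V :=
  insert u (H.neighborFinset u ∪ (H.neighborFinset u).biUnion fun w => H.neighborFinset w)

theorem card_ballTwo_le (H : SimpleGraph V) [DecidableRel H.Adj] (u : V) :
    #(H.ballTwo u) ≤ H.maxDegree ^ 2 + H.maxDegree + 1 := by
  have hdeg : ∀ w, #(H.neighborFinset w) ≤ H.maxDegree := fun w => by
    simpa using H.degree_le_maxDegree w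
  have h1 : #((H.neighborFinset u).biUnion fun w => H.neighborFinset w) ≤ H.maxDegree ^ 2 :=
    (card_biUnion_le_card_mul _ _ _ fun w _ => hdeg w).trans
      (by rw [sq]; exact Nat.mul_le_mul_right _ (hdeg u))
  have h2 := card_insert_le u
    (H.neighborFinset u ∪ (H.neighborFinset u).biUnion fun w => H.neighborFinset w)
  have h3 := card_union_le (H.neighborFinset u)
    ((H.neighborFinset u).biUnion fun w => H.neighborFinset w)
  have h4 := hdeg u
  unfold ballTwo
  omega

theorem IsSocial.two_mul_card_avoiding_le {G : SimpleGraph V} [DecidableRel G.Adj]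
    (hG : G.IsSocial) {u v : V} (hv : v ∉ Gᶜ.ballTwo u) :
    2 * #{s ∈ G.cliqueFamily | u ∉ s ∧ v ∉ s} ≤ #G.cliqueFamily := by
  simp only [ballTwo, mem_insert, mem_union, mem_biUnion, mem_neighborFinset, not_or,
    not_exists, not_and] at hv
  obtain ⟨hne, hnadj, hcommon⟩ := hv
  have hadj : G.Adj u v := by
    by_contra h
    exact hnadj ((compl_adj G u v).2 ⟨Ne.symm hne, h⟩)
  have key := two_mul_card_avoiding_le_cliqueCount_contractEdge (G := G) (Ne.symm hne)
    fun w hw => hcommon w hw.1 hw.2.symm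
  rw [card_cliqueFamily]
  convert Nat.le_trans key (hG u v hadj)

/-- A social graph has few rare vertices. -/
theorem IsSocial.card_le_of_forall_isRare {G : SimpleGraph V} [DecidableRel G.Adj]
    (hG : G.IsSocial) {B : Finset V} (hB : ∀ u ∈ B, G.IsRare u) :
    #B ≤ 98 * (Gᶜ.maxDegree ^ 2 + Gᶜ.maxDegree + 1) := by
  set K := Gᶜ.maxDegree ^ 2 + Gᶜ.maxDegree + 1
  set N := #G.cliqueFamily
  have hN : 0 < N := G.cliqueFamily_card_pos
  have hrow : ∀ u ∈ B, 2 * ∑ v ∈ B, #{s ∈ G.cliqueFamily | u ∉ s ∧ v ∉ s} ≤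
      #B * N + 2 * K * N := by
    intro u _
    calc 2 * ∑ v ∈ B, #{s ∈ G.cliqueFamily | u ∉ s ∧ v ∉ s}
        ≤ ∑ v ∈ B, (N + if v ∈ Gᶜ.ballTwo u then 2 * N else 0) := by
          rw [mul_sum]
          refine sum_le_sum fun v _ => ?_
          split_ifs with h
          · have : #{s ∈ G.cliqueFamily | u ∉ s ∧ v ∉ s} ≤ N := card_filter_le _ _
            omega
          · exact hG.two_mul_card_avoiding_le h
      _ = #B * N + #{v ∈ B | v ∈ Gᶜ.ballTwo u} * (2 * N) := by
          rw [sum_add_distrib, ← sum_filter]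
          simp
      _ ≤ #B * N + K * (2 * N) := by
          gcongr
          refine (card_le_card fun v hv => ?_).trans (card_ballTwo_le Gᶜ u)
          exact (mem_filter.1 hv).2
      _ = #B * N + 2 * K * N := by ring
  have hupper : 2 * ∑ u ∈ B, ∑ v ∈ B, #{s ∈ G.cliqueFamily | u ∉ s ∧ v ∉ s} ≤
      #B * (#B * N + 2 * K * N) := by
    rw [mul_sum]
    exact sum_le_card_nsmul _ _ _ hrow
  have hlower : 25 * #B ^ 2 * N ≤
      49 * ∑ u ∈ B, ∑ v ∈ B, #{s ∈ G.cliqueFamily | u ∉ s ∧ v ∉ s} := by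
    convert sum_card_avoiding_ge hB
  rcases Nat.eq_zero_or_pos #B with h0 | hpos
  · omega
  · refine Nat.le_of_mul_le_mul_left ?_ (Nat.mul_pos hpos hN)
    nlinarith

end SimpleGraph

/-- In a social graph whose complement has maximum degree `Δ`, all but at most `600 Δ³`
vertices have degree at most one in the complement. -/
theorem social_graph_almost_all_missing_degree_le_one {V : Type*} [Fintype V] [DecidableEq V]
    (G : SimpleGraph V) [DecidableRel G.Adj] (hG : G.IsSocial) :
    Nat.card {v : V // 1 < Gᶜ.degree v} ≤ 600 * Gᶜ.maxDegree ^ 3 := by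
  classical
  rw [Nat.subtype_card (univ.filter fun v => 1 < Gᶜ.degree v) (by simp)]
  rcases (univ.filter fun v => 1 < Gᶜ.degree v).eq_empty_or_nonempty with h0 | ⟨v₀, hv₀⟩
  · simp [h0]
  have hΔ : 2 ≤ Gᶜ.maxDegree :=
    (mem_filter.1 hv₀).2.trans_le (Gᶜ.degree_le_maxDegree v₀)
  set B : Finset V := univ.filter fun v => G.IsRare v
  have hB : #B ≤ 98 * (Gᶜ.maxDegree ^ 2 + Gᶜ.maxDegree + 1) :=
    hG.card_le_of_forall_isRare fun u hu => (mem_filter.1 hu).2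
  have hcover : (univ.filter fun v => 1 < Gᶜ.degree v) ⊆
      B.biUnion fun u => insert u (Gᶜ.neighborFinset u) := by
    intro v hv
    obtain ⟨a, ha, b, hb, hab⟩ := one_lt_card.1 (mem_filter.1 hv).2
    rw [SimpleGraph.mem_neighborFinset] at ha hb
    rw [mem_biUnion]
    rcases SimpleGraph.isRare_or_isRare_or_isRare ha hb hab with h | h | h
    · exact ⟨v, by simp [B, h], mem_insert_self _ _⟩
    · exact ⟨a, by simp [B, h],
        mem_insert_of_mem ((SimpleGraph.mem_neighborFinset _ _ _).2 ha.symm)⟩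
    · exact ⟨b, by simp [B, h],
        mem_insert_of_mem ((SimpleGraph.mem_neighborFinset _ _ _).2 hb.symm)⟩
  have hball : ∀ u ∈ B, #(insert u (Gᶜ.neighborFinset u)) ≤ Gᶜ.maxDegree + 1 := fun u _ =>
    (card_insert_le _ _).trans (Nat.succ_le_succ (Gᶜ.degree_le_maxDegree u))
  calc _ ≤ #B * (Gᶜ.maxDegree + 1) :=
        (card_le_card hcover).trans (card_biUnion_le_card_mul _ _ _ hball)
    _ ≤ 98 * (Gᶜ.maxDegree ^ 2 + Gᶜ.maxDegree + 1) * (Gᶜ.maxDegree + 1) :=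
        Nat.mul_le_mul_right _ hB
    _ ≤ 600 * Gᶜ.maxDegree ^ 3 := by
        obtain ⟨d, hd⟩ := Nat.exists_eq_add_of_le hΔ
        rw [hd]
        ring_nf
        nlinarith [Nat.zero_le d, Nat.zero_le (d ^ 2), Nat.zero_le (d ^ 3)]
end

section
/- Let H be a connected graph on t vertices and let x be the number of edges of a maximum matching in the complement of H. Let G' be a graph on 2a + b vertices consisting of the complement of a perfect matching on 2a vertices joined completely to a clique on b vertices (so the complement of G' is a matching of size a). Then H is not a minor of G' if and only if: 1.5a + b < t − 0.5x in the case a ≥ x, and 2a + b < t in the case a < x. -/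
namespace SimpleGraph

variable {V W : Type*}

/-- The sizes of matchings in a finite graph are bounded. -/
theorem bddAbove_ncard_edgeSet_isMatching [Fintype V] (G : SimpleGraph V) :
    BddAbove {k | ∃ M : G.Subgraph, M.IsMatching ∧ M.edgeSet.ncard = k} := by
  refine ⟨Nat.card (Sym2 V), ?_⟩
  rintro k ⟨M, -, rfl⟩
  exact Set.ncard_le_card _

/-- Pairwise disjoint edges of `G` indexed by `ι` bound the matching number from below. -/
theorem card_le_matchingNumber [Fintype V] {G : SimpleGraph V} {ι : Type*} [Fintype ι]
    (e : ι × Bool → V) (he : Function.Injective e)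
    (hadj : ∀ i, G.Adj (e (i, true)) (e (i, false))) :
    Fintype.card ι ≤ G.matchingNumber := by
  have hadj' : ∀ i β, G.Adj (e (i, β)) (e (i, !β)) := by
    rintro i (_ | _)
    exacts [(hadj i).symm, hadj i]
  let M : G.Subgraph :=
    { verts := Set.range e
      Adj := fun u v => ∃ i β, u = e (i, β) ∧ v = e (i, !β)
      adj_sub := by rintro u v ⟨i, β, rfl, rfl⟩; exact hadj' i β
      edge_vert := by rintro u v ⟨i, β, rfl, rfl⟩; exact ⟨_, rfl⟩
      symm := ⟨by rintro u v ⟨i, β, rfl, rfl⟩; exact ⟨i, !β, rfl, by simp⟩⟩ }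
  have hM : M.IsMatching := by
    rintro _ ⟨⟨i, β⟩, rfl⟩
    refine ⟨e (i, !β), ⟨i, β, rfl, rfl⟩, ?_⟩
    rintro _ ⟨j, γ, hj, rfl⟩
    obtain ⟨rfl, rfl⟩ := Prod.mk.inj (he hj)
    rfl
  refine le_trans ?_ (le_csSup G.bddAbove_ncard_edgeSet_isMatching ⟨M, hM, rfl⟩)
  rw [← Nat.card_eq_fintype_card, ← Nat.card_coe_set_eq]
  refine Nat.card_le_card_of_injective
    (fun i => (⟨s(e (i, true), e (i, false)), i, true, rfl, rfl⟩ : M.edgeSet)) ?_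
  intro i j hij
  have h := congrArg Subtype.val hij
  simp only [Sym2.eq_iff, he.eq_iff, Prod.mk.injEq] at h
  tauto

/-- A graph with matching number at least `m` contains `m` pairwise disjoint edges. -/
theorem exists_disjoint_edges_of_le_matchingNumber [Fintype V] {G : SimpleGraph V} {m : ℕ}
    (hm : m ≤ G.matchingNumber) :
    ∃ e : Fin m × Bool → V, Function.Injective e ∧
      ∀ i, G.Adj (e (i, true)) (e (i, false)) := by
  have hne : {k | ∃ M : G.Subgraph, M.IsMatching ∧ M.edgeSet.ncard = k}.Nonempty :=
    ⟨_, ⊥, by intro v hv; exact hv.elim, rfl⟩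
  obtain ⟨M, hM, hcard⟩ := Nat.sSup_mem hne G.bddAbove_ncard_edgeSet_isMatching
  have hle : Fintype.card (Fin m) ≤ Nat.card M.edgeSet := by
    rw [Fintype.card_fin, Nat.card_coe_set_eq, hcard]
    exact hm
  have : Fintype M.edgeSet := Fintype.ofFinite _
  rw [Nat.card_eq_fintype_card] at hle
  obtain ⟨k⟩ := Function.Embedding.nonempty_of_card_le hle
  have hk : ∀ i, ∃ p : V × V, M.Adj p.1 p.2 ∧ (k i : Sym2 V) = s(p.1, p.2) := by
    intro i
    obtain ⟨s, hs⟩ := k i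
    induction s with
    | _ u v => exact ⟨(u, v), hs, rfl⟩
  choose p hp hkp using hk
  have huniq : ∀ {u v w}, M.Adj u v → M.Adj u w → v = w := fun hv hw =>
    (hM (M.edge_vert hv)).unique hv hw
  have hinj : ∀ i j, s((p i).1, (p i).2) = s((p j).1, (p j).2) → i = j := by
    intro i j h
    apply k.injective
    apply Subtype.ext
    rw [hkp, hkp, h]
  refine ⟨fun q => if q.2 then (p q.1).1 else (p q.1).2, ?_, fun i => by simpa using (hp i).adj_sub⟩
  rintro ⟨i, β⟩ ⟨j, γ⟩ h
  have hi := hp i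
  have hj := hp j
  have hij : i = j := by
    apply hinj
    rw [Sym2.eq_iff]
    cases β <;> cases γ <;> simp only [if_true, Bool.false_eq_true, if_false] at h
    · rw [← h] at hj ⊢
      exact .inl ⟨huniq hi.symm hj.symm, rfl⟩
    · rw [← h] at hj ⊢
      exact .inr ⟨huniq hi.symm hj, rfl⟩
    · rw [← h] at hj ⊢
      exact .inr ⟨rfl, huniq hi hj.symm⟩
    · rw [← h] at hj ⊢
      exact .inl ⟨rfl, huniq hi hj⟩
  subst hij
  have := hi.ne
  cases β <;> cases γ <;> simp_all

/-- Branch sets with at most two vertices each, given as pairs `{p w, q w}`. -/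
theorem IsMinor.of_pairs {H : SimpleGraph W} {G : SimpleGraph V} (p q : W → V)
    (hpq : ∀ w, p w = q w ∨ G.Adj (p w) (q w))
    (hdisj : ∀ w w', w ≠ w' → p w ≠ p w' ∧ p w ≠ q w' ∧ q w ≠ q w')
    (hadj : ∀ w w', H.Adj w w' → G.Adj (p w) (p w') ∨ G.Adj (p w) (q w') ∨
      G.Adj (q w) (p w') ∨ G.Adj (q w) (q w')) :
    H.IsMinor G := by
  refine ⟨fun w => {p w, q w}, fun w => ⟨p w, by simp⟩, fun w => ?_, fun w w' h => ?_,
    fun w w' h => ?_⟩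
  · rcases hpq w with h | h
    · beta_reduce
      rw [h, Set.pair_eq_singleton, induce_singleton_eq_top]
      exact connected_top
    · exact induce_pair_connected_of_adj h
  · have h₁ := hdisj w w' h
    have h₂ := hdisj w' w h.symm
    simp only [Set.disjoint_left, Set.mem_insert_iff, Set.mem_singleton_iff]
    grind
  · simpa [or_assoc] using hadj w w' h

/-- A minor of a finite graph has at most as many vertices. -/
theorem IsMinor.card_le [Fintype V] [Fintype W] {H : SimpleGraph W} {G : SimpleGraph V}
    (h : H.IsMinor G) : Fintype.card W ≤ Fintype.card V := by
  obtain ⟨f, hne, -, hdisj, -⟩ := h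
  choose g hg using hne
  refine Fintype.card_le_of_injective g fun w w' hw => ?_
  by_contra hww
  exact Set.disjoint_left.1 (hdisj hww) (hg w) (hw ▸ hg w')

end SimpleGraph

open SimpleGraph

/-- Twice the order of a minor of `matchingJoinClique a b` is at most
`3a + 2b` plus the matching number of the complement of the minor: a branch set either is a
singleton or uses two vertices, and each matched pair consisting of two singleton branch sets
gives an edge of a matching in the complement. -/
theorem two_mul_card_le_of_isMinor_matchingJoinClique {W : Type*} [Fintype W]
    {H : SimpleGraph W} {a b : ℕ} (h : H.IsMinor (matchingJoinClique a b)) :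
    2 * Fintype.card W ≤ 3 * a + 2 * b + Hᶜ.matchingNumber := by
  classical
  obtain ⟨f, hne, -, hdisj, hadj⟩ := h
  let c : (Fin a × Bool) ⊕ Fin b → ℕ := fun v => if ∃ w, f w = {v} then 2 else 1
  have hc : ∀ v, 1 ≤ c v ∧ c v ≤ 2 := fun v => by
    by_cases hv : ∃ w, f w = {v} <;> simp [c, hv]
  have hfc : ∀ w, 2 ≤ ∑ v ∈ (f w).toFinset, c v := by
    intro w
    obtain ⟨v, hv⟩ := hne w
    by_cases hs : ∃ u ∈ f w, u ≠ v
    · obtain ⟨u, hu, huv⟩ := hs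
      calc 2 ≤ c u + c v := by have := hc u; have := hc v; omega
        _ = ∑ z ∈ {u, v}, c z := (Finset.sum_pair huv).symm
        _ ≤ _ := Finset.sum_le_sum_of_subset (by
          intro z hz
          simp only [Finset.mem_insert, Finset.mem_singleton] at hz
          rw [Set.mem_toFinset]
          rcases hz with rfl | rfl <;> assumption)
    · push Not at hs
      have hw : f w = {v} := Set.eq_singleton_iff_unique_mem.2 ⟨hv, hs⟩
      have hcv : c v = 2 := if_pos ⟨w, hw⟩
      rw [← hcv]
      exact Finset.single_le_sum (f := c) (fun _ _ => Nat.zero_le _) (Set.mem_toFinset.2 hv)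
  let P : Finset (Fin a) :=
    {i | ∀ β, ∃ w, f w = {Sum.inl (i, β)}}
  have hP : P.card ≤ Hᶜ.matchingNumber := by
    have hP' : ∀ q : P × Bool, ∃ w, f w = {Sum.inl (q.1.1, q.2)} := fun q =>
      (Finset.mem_filter.1 q.1.2).2 q.2
    choose e he using hP'
    have hinj : Function.Injective e := by
      intro q r hqr
      have h₁ := he q
      rw [hqr, he r, Set.singleton_eq_singleton_iff] at h₁
      grind
    rw [← Fintype.card_coe]
    refine card_le_matchingNumber e hinj fun i => ?_
    rw [compl_adj]
    refine ⟨fun hi => by simpa using hinj hi, fun hi => ?_⟩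
    obtain ⟨u, hu, v, hv, huv⟩ := hadj hi
    rw [he, Set.mem_singleton_iff] at hu hv
    subst hu hv
    exact huv rfl
  have hpair : ∀ i, c (.inl (i, true)) + c (.inl (i, false)) ≤ 3 + if i ∈ P then 1 else 0 := by
    intro i
    by_cases hi : i ∈ P
    · have h₁ := hc (.inl (i, true))
      have h₂ := hc (.inl (i, false))
      rw [if_pos hi]
      omega
    · have hi' : ¬ ∀ β, ∃ w, f w = {Sum.inl (i, β)} := fun h =>
        hi (Finset.mem_filter.2 ⟨Finset.mem_univ _, h⟩)
      rw [not_forall] at hi'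
      obtain ⟨β, hβ⟩ := hi'
      have h₁ : c (.inl (i, β)) = 1 := if_neg hβ
      have h₂ := hc (.inl (i, !β))
      rw [if_neg hi]
      cases β <;> simp only [Bool.not_true, Bool.not_false] at h₂ <;> omega
  calc 2 * Fintype.card W = ∑ _w : W, 2 := by simp [mul_comm]
    _ ≤ ∑ w : W, ∑ v ∈ (f w).toFinset, c v := Finset.sum_le_sum fun w _ => hfc w
    _ = ∑ v ∈ Finset.univ.biUnion fun w => (f w).toFinset, c v :=
      (Finset.sum_biUnion fun w _ w' _ hw => Set.disjoint_toFinset.2 (hdisj hw)).symm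
    _ ≤ ∑ v, c v := Finset.sum_le_sum_of_subset (Finset.subset_univ _)
    _ = ∑ i, (c (.inl (i, true)) + c (.inl (i, false))) + ∑ j, c (.inr j) := by
      simp [Fintype.sum_sum_type, Fintype.sum_prod_type]
    _ ≤ ∑ i : Fin a, (3 + if i ∈ P then 1 else 0) + ∑ _j : Fin b, 2 :=
      add_le_add (Finset.sum_le_sum fun i _ => hpair i) (Finset.sum_le_sum fun j _ => (hc _).2)
    _ = 3 * a + 2 * b + P.card := by
      simp [Finset.sum_add_distrib]
      ring
    _ ≤ _ := by omega

/-- If the complement of `H` contains `m ≤ a` disjoint edges, these can be placed on `m` of the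
matched pairs; each of the other `a - m` pairs provides a singleton branch set, and the remaining
vertices are grouped two by two. -/
theorem isMinor_matchingJoinClique {W : Type*} [Fintype W] {H : SimpleGraph W} {a b m : ℕ}
    (hma : m ≤ a) (e : Fin m × Bool → W) (he : Function.Injective e)
    (hadj : ∀ i, Hᶜ.Adj (e (i, true)) (e (i, false)))
    (hcard : Fintype.card W ≤ 2 * m + (b + ((a - m) + (a - m) / 2))) :
    H.IsMinor (matchingJoinClique a b) := by
  classical
  have hle : Fintype.card {w // w ∉ Set.range e} ≤
      Fintype.card (Fin b ⊕ (Fin (a - m) ⊕ Fin ((a - m) / 2))) := by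
    have h₁ := Fintype.card_subtype_compl (fun w => w ∈ Set.range e)
    have h₂ : Fintype.card {w // w ∈ Set.range e} = m * 2 := by
      rw [← Fintype.card_congr (Equiv.ofInjective e he)]
      simp
    simp only [Fintype.card_sum, Fintype.card_fin]
    omega
  obtain ⟨k⟩ := Function.Embedding.nonempty_of_card_le hle
  obtain ⟨g, hg, hge⟩ : ∃ g : W → (Fin m × Bool) ⊕ (Fin b ⊕ (Fin (a - m) ⊕ Fin ((a - m) / 2))),
      Function.Injective g ∧ ∀ w s, g w = .inl s → w = e s := by
    refine ⟨fun w => if h : w ∈ Set.range e then .inl h.choose else .inr (k ⟨w, h⟩), ?_, ?_⟩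
    · intro w w' h
      by_cases hw : w ∈ Set.range e <;> by_cases hw' : w' ∈ Set.range e <;>
        simp only [hw, hw', dif_pos, dif_neg, not_false_eq_true, Sum.inl.injEq, Sum.inr.injEq,
          reduceCtorEq] at h
      · rw [← hw.choose_spec, ← hw'.choose_spec, h]
      · exact congrArg Subtype.val (k.injective h)
    · intro w s h
      by_cases hw : w ∈ Set.range e
      · simp only [hw, dif_pos, Sum.inl.injEq] at h
        rw [← h, hw.choose_spec]
      · simp [hw] at h
  let pick (d : Fin 2) : (Fin m × Bool) ⊕ (Fin b ⊕ (Fin (a - m) ⊕ Fin ((a - m) / 2))) →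
      (Fin a × Bool) ⊕ Fin b
    | .inl (i, β) => .inl (⟨i, by omega⟩, β)
    | .inr (.inl j) => .inr j
    | .inr (.inr (.inl i)) => .inl (⟨m + i, by omega⟩, true)
    | .inr (.inr (.inr i)) => .inl (⟨m + 2 * i + d, by omega⟩, false)
  have hdisj : ∀ d d' s s', s ≠ s' → pick d s ≠ pick d' s' := by
    rintro d d' (⟨i, β⟩ | j | i | i) (⟨i', β'⟩ | j' | i' | i') hs <;>
      simp only [pick, ne_eq, Sum.inl.injEq, Sum.inr.injEq, Prod.mk.injEq,
        Fin.ext_iff, reduceCtorEq, not_false_eq_true] at hs ⊢ <;> grind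
  have hedge : ∀ s s', s ≠ s' → (∀ i β, s = .inl (i, β) → s' ≠ .inl (i, !β)) →
      ∃ d d', (matchingJoinClique a b).Adj (pick d s) (pick d' s') := by
    rintro (⟨i, β⟩ | j | i | i) (⟨i', β'⟩ | j' | i' | i') hs hne <;>
      simp only [pick, matchingJoinClique, ne_eq, Sum.inl.injEq, Sum.inr.injEq, Prod.mk.injEq,
        Fin.ext_iff, reduceCtorEq, not_false_eq_true, exists_const, Fin.exists_fin_two, Fin.val_zero,
        Fin.val_one] at hs hne ⊢
    · intro hi
      exact hne i β ⟨rfl, rfl⟩ ⟨hi.symm, Bool.eq_not_of_ne fun hβ => hs ⟨hi, hβ.symm⟩⟩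
    all_goals grind
  refine IsMinor.of_pairs (fun w => pick 0 (g w)) (fun w => pick 1 (g w)) (fun w => ?_)
    (fun w w' h => ?_) (fun w w' h => ?_)
  · generalize g w = s
    rcases s with ⟨i, β⟩ | j | i | i <;> simp [pick, matchingJoinClique]
  · have := hg.ne h
    exact ⟨hdisj _ _ _ _ this, hdisj _ _ _ _ this, hdisj _ _ _ _ this⟩
  · have := hedge (g w) (g w') (hg.ne h.ne) fun i β h₁ h₂ => by
      have h₃ := (hadj i).2
      rw [hge _ _ h₁, hge _ _ h₂] at h
      cases β
      exacts [h₃ h.symm, h₃ h]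
    simpa only [Fin.exists_fin_two, or_assoc] using this

/-- Let `H` be a connected graph on `t` vertices whose complement has maximum matching
size `x`, and let `G'` be the complement of a perfect matching on `2a` vertices joined
completely to a clique on `b` vertices. Then `H` is not a minor of `G'` iff
`1.5a + b < t - 0.5x` when `a ≥ x`, and `2a + b < t` when `a < x`. -/
theorem not_minor_matchingJoinClique_iff {W : Type*} [Fintype W] (H : SimpleGraph W)
    (hconn : H.Connected) (t : ℕ) (ht : Fintype.card W = t) (x : ℕ)
    (hx : Hᶜ.matchingNumber = x) (a b : ℕ) :
    ¬ H.IsMinor (matchingJoinClique a b) ↔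
      ((x ≤ a → 3 * a + 2 * b + x < 2 * t) ∧ (a < x → 2 * a + b < t)) := by
  subst ht hx
  constructor
  · intro h
    obtain ⟨e, he, hadj⟩ :=
      exists_disjoint_edges_of_le_matchingNumber (min_le_right a Hᶜ.matchingNumber)
    have := mt (isMinor_matchingJoinClique (b := b) (min_le_left _ _) e he hadj) h
    omega
  · rintro ⟨h₁, h₂⟩ h
    have h₃ := two_mul_card_le_of_isMinor_matchingJoinClique h
    have h₄ := h.card_le
    simp only [Fintype.card_sum, Fintype.card_prod, Fintype.card_fin, Fintype.card_bool] at h₄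
    omega
end
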